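/- Fix α with 0 < α < 1/2. For ε > 0 define the continuous ℤ²-periodic function f_{α,ε} : ℝ² → ℝ by f_{α,ε}(x) = ε² / (ε² + min(dist(x, ℤ²), α)²), where dist(x, ℤ²) is the Euclidean distance from x to the lattice ℤ². Then liminf_{ε → 0⁺} μ₁(f_{α,ε}) · ∫_{[0,1]²} f_{α,ε}(x)² dx ≥ 8π; equivalently, liminf_{ε → 0⁺} ε² μ₁(f_{α,ε}) ≥ 8. -/

import Mathlib

open MeasureTheory Real Filter

/-- A function on the Euclidean plane is `ℤ²`-periodic if it is invariant under
translation by both standard basis vectors (equivalently, by every lattice vector). -/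
def ZsqPeriodic (w : EuclideanSpace ℝ (Fin 2) → ℝ) : Prop :=
  ∀ x : EuclideanSpace ℝ (Fin 2), ∀ i : Fin 2, w (x + EuclideanSpace.single i 1) = w x

/-- The fundamental domain `[0,1]²` of the torus `ℝ²/ℤ²`. -/
def unitSquare : Set (EuclideanSpace ℝ (Fin 2)) :=
  {x | ∀ i : Fin 2, x i ∈ Set.Icc (0 : ℝ) 1}

/-- First nonzero eigenvalue of the Laplacian of the generalized metric `h² g_flat`
on the flat torus `ℝ²/ℤ²`, defined via the Rayleigh quotient. -/
noncomputable def mu1 (h : EuclideanSpace ℝ (Fin 2) → ℝ) : ℝ :=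
  sInf { r : ℝ | ∃ u : EuclideanSpace ℝ (Fin 2) → ℝ,
    ContDiff ℝ (⊤ : ℕ∞) u ∧ ZsqPeriodic u ∧ u ≠ 0 ∧
    (∫ x in unitSquare, u x * (h x) ^ 2) = 0 ∧
    r = (∫ x in unitSquare, ‖gradient u x‖ ^ 2) /
          (∫ x in unitSquare, (u x) ^ 2 * (h x) ^ 2) }

/-- Euclidean distance from a point of the plane to the lattice `ℤ²`. -/
noncomputable def latticeDist (x : EuclideanSpace ℝ (Fin 2)) : ℝ :=
  Metric.infDist x {y : EuclideanSpace ℝ (Fin 2) | ∀ i : Fin 2, ∃ m : ℤ, y i = (m : ℝ)}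

/-- The `ℤ²`-periodic conformal factor `f_{α,ε}(x) = ε²/(ε² + min(dist(x,ℤ²),α)²)`. -/
noncomputable def fae (α ε : ℝ) (x : EuclideanSpace ℝ (Fin 2)) : ℝ :=
  ε ^ 2 / (ε ^ 2 + (min (latticeDist x) α) ^ 2)

lemma pos_of_forall_lt_one {A B : ℝ} (h : ∀ k ∈ Set.Ioo (0:ℝ) 1, k ^ 2 * A ≤ B) : A ≤ B := by
  have h1 : Tendsto (fun k : ℝ => k ^ 2 * A) (nhdsWithin 1 (Set.Iio 1)) (nhds (1 ^ 2 * A)) := by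
    apply Tendsto.mono_left _ nhdsWithin_le_nhds
    exact (Continuous.tendsto (by fun_prop) 1)
  rw [one_pow, one_mul] at h1
  refine le_of_tendsto h1 ?_
  filter_upwards [Ioo_mem_nhdsLT (show (0:ℝ) < 1 by norm_num)] with k hk using h k hk

/-- Dirichlet Wirtinger inequality on an interval of length `π`. -/
lemma wirtinger_dirichlet (a : ℝ) (f f' : ℝ → ℝ) (hf : ∀ x, HasDerivAt f (f' x) x)
    (hf' : Continuous f') (h0 : f a = 0) (h1 : f (a + π) = 0) :
    ∫ x in a..(a + π), f x ^ 2 ≤ ∫ x in a..(a + π), f' x ^ 2 := by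
  have hfc : Continuous f := continuous_iff_continuousAt.2 fun x => (hf x).continuousAt
  have hpi := Real.pi_pos
  apply pos_of_forall_lt_one
  intro k hk
  obtain ⟨hk0, hk1⟩ := hk
  set s : ℝ → ℝ := fun x => Real.sin (k * (x - a) + (1 - k) * π / 2) with hs
  set c : ℝ → ℝ := fun x => Real.cos (k * (x - a) + (1 - k) * π / 2) with hc
  have hsd : ∀ x, HasDerivAt s (k * c x) x := by
    intro x
    have h2 : HasDerivAt (fun x : ℝ => k * (x - a) + (1 - k) * π / 2) k x := by
      have := (((hasDerivAt_id x).sub_const a).const_mul k).add_const ((1 - k) * π / 2)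
      simpa using this
    simpa [hs, hc, mul_comm] using h2.sin
  have hcd : ∀ x, HasDerivAt c (-k * s x) x := by
    intro x
    have h2 : HasDerivAt (fun x : ℝ => k * (x - a) + (1 - k) * π / 2) k x := by
      have := (((hasDerivAt_id x).sub_const a).const_mul k).add_const ((1 - k) * π / 2)
      simpa using this
    simpa [hs, hc, mul_comm] using h2.cos
  have hspos : ∀ x ∈ Set.Icc a (a + π), 0 < s x := by
    intro x hx
    apply Real.sin_pos_of_pos_of_lt_pi
    · have : 0 ≤ k * (x - a) := mul_nonneg hk0.le (by linarith [hx.1])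
      have : 0 < (1 - k) * π := mul_pos (by linarith) hpi
      linarith
    · have : k * (x - a) ≤ k * π := mul_le_mul_of_nonneg_left (by linarith [hx.2]) hk0.le
      have : 0 < (1 - k) * π := mul_pos (by linarith) hpi
      linarith
  have hsc : ∀ x, s x ^ 2 + c x ^ 2 = 1 := fun x => Real.sin_sq_add_cos_sq _
  have hscont : Continuous s := by fun_prop
  have hccont : Continuous c := by fun_prop
  have huI : Set.uIcc a (a + π) = Set.Icc a (a + π) := Set.uIcc_of_le (by linarith)
  -- total derivative
  have hG : ∀ x ∈ Set.uIcc a (a + π), HasDerivAt (fun x => k * c x / s x * f x ^ 2)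
      (((k * (-k * s x)) * s x - k * c x * (k * c x)) / s x ^ 2 * f x ^ 2 +
        k * c x / s x * (2 * f x * f' x)) x := by
    intro x hx
    rw [huI] at hx
    have := (((hcd x).const_mul k).div (hsd x) (hspos x hx).ne').mul ((hf x).pow 2)
    exact this.congr_deriv (by simp)
  have hcont : ContinuousOn (fun x => (((k * (-k * s x)) * s x - k * c x * (k * c x)) / s x ^ 2 * f x ^ 2 +
        k * c x / s x * (2 * f x * f' x))) (Set.uIcc a (a + π)) := by
    rw [huI]
    apply ContinuousOn.add
    · apply ContinuousOn.mul _ (by fun_prop)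
      exact ContinuousOn.div (by fun_prop) (by fun_prop) fun x hx => (pow_pos (hspos x hx) 2).ne'
    · apply ContinuousOn.mul _ (by fun_prop)
      exact ContinuousOn.div (by fun_prop) (by fun_prop) fun x hx => (hspos x hx).ne'
  have hintg := intervalIntegral.integral_eq_sub_of_hasDerivAt hG hcont.intervalIntegrable
  simp only [h0, h1] at hintg
  have hle : ∫ x in a..(a + π), (k ^ 2 * f x ^ 2 + (((k * (-k * s x)) * s x - k * c x * (k * c x)) / s x ^ 2 * f x ^ 2 +
        k * c x / s x * (2 * f x * f' x))) ≤ ∫ x in a..(a + π), f' x ^ 2 := by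
    apply intervalIntegral.integral_mono_on (by linarith)
    · apply IntervalIntegrable.add _ hcont.intervalIntegrable
      exact Continuous.intervalIntegrable (by fun_prop) _ _
    · exact Continuous.intervalIntegrable (by fun_prop) _ _
    · intro x hx
      have hp := (hspos x hx).ne'
      have h3 : f' x ^ 2 - (k ^ 2 * f x ^ 2 + (((k * (-k * s x)) * s x - k * c x * (k * c x)) / s x ^ 2 * f x ^ 2 +
        k * c x / s x * (2 * f x * f' x))) = (f' x - k * c x / s x * f x) ^ 2 := by
        field_simp
        ring
      nlinarith [sq_nonneg (f' x - k * c x / s x * f x)]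
  rw [intervalIntegral.integral_add (Continuous.intervalIntegrable (by fun_prop) _ _) hcont.intervalIntegrable,
    intervalIntegral.integral_const_mul, hintg] at hle
  linarith

/-- Wirtinger inequality on the circle. -/
lemma wirtinger (f f' : ℝ → ℝ) (hf : ∀ x, HasDerivAt f (f' x) x)
    (hf' : Continuous f') (hper : ∀ x, f (x + 2 * π) = f x) (hper' : ∀ x, f' (x + 2 * π) = f' x)
    (m : ℝ) (hm : ∫ x in (-π)..π, f x = 2 * π * m) :
    ∫ x in (-π)..π, (f x - m) ^ 2 ≤ ∫ x in (-π)..π, f' x ^ 2 := by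
  have hfc : Continuous f := continuous_iff_continuousAt.2 fun x => (hf x).continuousAt
  have hpi := Real.pi_pos
  obtain ⟨a, ha⟩ : ∃ a, f a = f (a + π) := by
    have hc : Continuous (fun x => f (x + π) - f x) := by fun_prop
    have hz : (0:ℝ) ∈ Set.uIcc ((fun x => f (x + π) - f x) 0) ((fun x => f (x + π) - f x) π) := by
      have : f (π + π) = f 0 := by rw [← hper 0]; ring_nf
      simp only [this, zero_add]
      rw [Set.mem_uIcc]
      rcases le_total (f 0) (f π) with h | h
      · right; constructor <;> linarith
      · left; constructor <;> linarith
    obtain ⟨x, _, hx⟩ := intermediate_value_uIcc (hc.continuousOn) hz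
    exact ⟨x, by simp only at hx; linarith⟩
  set A := f a with hA
  have e1 := wirtinger_dirichlet a (fun x => f x - A) f' (fun x => (hf x).sub_const A) hf' (by simp [hA])
    (by simp [← ha])
  have e2 := wirtinger_dirichlet (a + π) (fun x => f x - A) f' (fun x => (hf x).sub_const A) hf' (by simp [← ha])
    (by simp only [add_assoc, ← two_mul, hper, hA, sub_self])
  have ii : ∀ g : ℝ → ℝ, Continuous g → ∀ x y, IntervalIntegrable g volume x y :=
    fun g hg x y => hg.intervalIntegrable x y
  have e3 : ∫ x in a..(a + π + π), (f x - A) ^ 2 ≤ ∫ x in a..(a + π + π), f' x ^ 2 := by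
    rw [← intervalIntegral.integral_add_adjacent_intervals (ii _ (by fun_prop) a (a + π)) (ii _ (by fun_prop) (a+π) (a + π + π)),
     ← intervalIntegral.integral_add_adjacent_intervals (ii _ (by fun_prop) a (a + π)) (ii _ (by fun_prop) (a+π) (a + π + π))]
    linarith
  have p1 : Function.Periodic (fun x => (f x - A) ^ 2) (2 * π) := fun x => by simp [hper]
  have p2 : Function.Periodic (fun x => (f' x) ^ 2) (2 * π) := fun x => by simp [hper']
  have q1 := p1.intervalIntegral_add_eq a (-π)
  have q2 := p2.intervalIntegral_add_eq a (-π)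
  have r1 : a + 2 * π = a + π + π := by ring
  have r2 : -π + 2 * π = π := by ring
  rw [r1, r2] at q1 q2
  rw [q1, q2] at e3
  refine le_trans ?_ e3
  have x1 : ∫ x in (-π)..π, (f x - A) ^ 2 = ∫ x in (-π)..π, ((f x - m) ^ 2 + (2 * (m - A) * f x + (A ^ 2 - m ^ 2))) := by
    congr 1; ext x; ring
  rw [x1, intervalIntegral.integral_add (ii _ (by fun_prop) _ _) (ii _ (by fun_prop) _ _),
    intervalIntegral.integral_add (ii _ (by fun_prop) _ _) (ii _ (by fun_prop) _ _),
    intervalIntegral.integral_const_mul, hm, intervalIntegral.integral_const]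
  have : 0 ≤ 2 * (m - A) * (2 * π * m) + (π - -π) • (A ^ 2 - m ^ 2) := by
    rw [smul_eq_mul]
    have : 2 * (m - A) * (2 * π * m) + (π - -π) * (A ^ 2 - m ^ 2) = 2 * π * (m - A) ^ 2 := by ring
    rw [this]; positivity
  linarith

lemma deriv_param (a b : ℝ) (f f' : ℝ → ℝ → ℝ) (hf : Continuous (Function.uncurry f))
    (hf' : Continuous (Function.uncurry f'))
    (hd : ∀ r t, HasDerivAt (fun r => f r t) (f' r t) r) (r : ℝ) :
    HasDerivAt (fun r => ∫ t in a..b, f r t) (∫ t in a..b, f' r t) r := by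
  have hK : IsCompact (Set.Icc (r - 1) (r + 1) ×ˢ Set.uIcc a b) := isCompact_Icc.prod isCompact_uIcc
  obtain ⟨C, hC⟩ := hK.exists_bound_of_continuousOn hf'.continuousOn
  have h1 : ∀ r, Continuous (f r) := fun r => by
    have : f r = Function.uncurry f ∘ fun t => (r, t) := rfl
    rw [this]; fun_prop
  have h2 : ∀ r, Continuous (f' r) := fun r => by
    have : f' r = Function.uncurry f' ∘ fun t => (r, t) := rfl
    rw [this]; fun_prop
  refine (intervalIntegral.hasDerivAt_integral_of_dominated_loc_of_deriv_le (F := f) (F' := f')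
    (bound := fun _ => C) (s := Set.Icc (r - 1) (r + 1))
    (Icc_mem_nhds (by linarith) (by linarith)) ?_ ?_ ?_ ?_ ?_ ?_).2
  · exact Eventually.of_forall fun x => (h1 x).aestronglyMeasurable
  · exact (h1 r).intervalIntegrable _ _
  · exact (h2 r).aestronglyMeasurable
  · refine Eventually.of_forall fun t ht x hx => ?_
    exact hC (x, t) ⟨hx, Set.uIoc_subset_uIcc ht⟩
  · simp
  · exact Eventually.of_forall fun t _ x _ => hd x t

/-- Riccati supersolution data. -/
def Ric (q a b : ℝ) (W F F' : ℝ → ℝ) : Prop :=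
  (∀ r ∈ Set.Icc a b, HasDerivAt F (F' r) r) ∧ ContinuousOn F' (Set.Icc a b) ∧
    ∀ r ∈ Set.Ioo a b, F' r + F r ^ 2 / r ≤ q / r - W r * r

lemma Ric.cont {q a b : ℝ} {W F F' : ℝ → ℝ} (h : Ric q a b W F F') : ContinuousOn F (Set.Icc a b) :=
  fun r hr => (h.1 r hr).continuousAt.continuousWithinAt

lemma ric_point {r q W F F' g g' : ℝ} (hr : 0 < r) (h : F' + F ^ 2 / r ≤ q / r - W * r) :
    (F' * g ^ 2 + F * (2 * g * g')) + W * r * g ^ 2 ≤ r * g' ^ 2 + q * g ^ 2 / r := by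
  have e : r * g' ^ 2 + q * g ^ 2 / r - ((F' * g ^ 2 + F * (2 * g * g')) + W * r * g ^ 2) =
    r * (g' - F * g / r) ^ 2 + (q / r - W * r - (F' + F ^ 2 / r)) * g ^ 2 := by
    field_simp
    ring
  have : 0 ≤ r * (g' - F * g / r) ^ 2 + (q / r - W * r - (F' + F ^ 2 / r)) * g ^ 2 := by
    apply add_nonneg (by positivity)
    exact mul_nonneg (by linarith) (sq_nonneg _)
  linarith

lemma ric0 {a b : ℝ} {W F F' g g' : ℝ → ℝ} (h : Ric 0 a b W F F') (ha : 0 ≤ a) (hab : a ≤ b)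
    (hW : ContinuousOn W (Set.Icc a b)) (hg : ∀ r, HasDerivAt g (g' r) r) (hg' : Continuous g') :
    F b * g b ^ 2 - F a * g a ^ 2 + ∫ r in a..b, W r * r * g r ^ 2 ≤ ∫ r in a..b, r * g' r ^ 2 := by
  have hgc : Continuous g := continuous_iff_continuousAt.2 fun x => (hg x).continuousAt
  have huI : Set.uIcc a b = Set.Icc a b := Set.uIcc_of_le hab
  have hFc := h.cont
  have hFc' := h.2.1
  have hD : ∀ x ∈ Set.uIcc a b, HasDerivAt (fun r => F r * g r ^ 2)
      (F' x * g x ^ 2 + F x * (2 * g x * g' x)) x := by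
    intro x hx
    rw [huI] at hx
    exact ((h.1 x hx).mul ((hg x).pow 2)).congr_deriv (by simp)
  have hc1 : ContinuousOn (fun x => F' x * g x ^ 2 + F x * (2 * g x * g' x)) (Set.uIcc a b) := by
    rw [huI]; fun_prop
  have hc2 : ContinuousOn (fun x => W x * x * g x ^ 2) (Set.uIcc a b) := by
    rw [huI]; fun_prop
  rw [← intervalIntegral.integral_eq_sub_of_hasDerivAt hD hc1.intervalIntegrable,
    ← intervalIntegral.integral_add hc1.intervalIntegrable hc2.intervalIntegrable]
  apply intervalIntegral.integral_mono_on_of_le_Ioo hab (hc1.add hc2).intervalIntegrable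
    (Continuous.intervalIntegrable (by fun_prop) _ _)
  intro r hr
  have := ric_point (g := g r) (g' := g' r) (lt_of_le_of_lt ha hr.1) (h.2.2 r hr)
  simpa using this

lemma disc (P Pr Pt e : ℝ → ℝ → ℝ) (hP : Continuous (Function.uncurry P))
    (hPr : Continuous (Function.uncurry Pr)) (hPt : Continuous (Function.uncurry Pt))
    (he : Continuous (Function.uncurry e))
    (hdr : ∀ r t, HasDerivAt (fun r => P r t) (Pr r t) r)
    (hdt : ∀ r t, HasDerivAt (fun t => P r t) (Pt r t) t)
    (hper : ∀ r t, P r (t + 2 * π) = P r t) (hper' : ∀ r t, Pt r (t + 2 * π) = Pt r t)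
    (P0 : ℝ) (hP0 : ∀ t, P 0 t = P0)
    (hE : ∀ r t, r ^ 2 * e r t = r ^ 2 * Pr r t ^ 2 + Pt r t ^ 2)
    (ε R : ℝ) (hε : 0 < ε) (hεR : ε ≤ R) :
    ∃ c : ℝ, ∀ W F F' A A' B B' : ℝ → ℝ, ContinuousOn W (Set.Icc 0 R) →
      Ric 1 0 R W F F' → Ric 0 0 ε W A A' → Ric 0 ε R W B B' → 0 ≤ F R → A 0 ≤ 0 → 0 ≤ B R →
      ∫ r in (0:ℝ)..R, W r * r * ∫ t in (-π)..π, (P r t - c) ^ 2 ≤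
      ∫ r in (0:ℝ)..R, r * ∫ t in (-π)..π, e r t := by
  have hpi := Real.pi_pos
  have sl : ∀ f : ℝ → ℝ → ℝ, Continuous (Function.uncurry f) → ∀ r, Continuous (f r) := fun f hf r => by
    have : f r = Function.uncurry f ∘ fun t => (r, t) := rfl
    rw [this]; fun_prop
  have ii : ∀ g : ℝ → ℝ, Continuous g → IntervalIntegrable g volume (-π) π :=
    fun g hg => hg.intervalIntegrable _ _
  set m : ℝ → ℝ := fun r => (2 * π)⁻¹ * ∫ t in (-π)..π, P r t with hm
  set m' : ℝ → ℝ := fun r => (2 * π)⁻¹ * ∫ t in (-π)..π, Pr r t with hm'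
  have hmI : ∀ r, ∫ t in (-π)..π, P r t = 2 * π * m r := fun r => by simp only [hm]; field_simp
  have hmI' : ∀ r, ∫ t in (-π)..π, Pr r t = 2 * π * m' r := fun r => by simp only [hm']; field_simp
  have hmd : ∀ r, HasDerivAt m (m' r) r := fun r => (deriv_param _ _ P Pr hP hPr hdr r).const_mul _
  have hmc' : Continuous m' := by
    apply Continuous.mul continuous_const
    exact intervalIntegral.continuous_parametric_intervalIntegral_of_continuous' hPr _ _
  have hmc : Continuous m := continuous_iff_continuousAt.2 fun x => (hmd x).continuousAt
  -- the angular part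
  set V : ℝ → ℝ := fun r => ∫ t in (-π)..π, (P r t - m r) ^ 2 with hV
  set V' : ℝ → ℝ := fun r => ∫ t in (-π)..π, 2 * (P r t - m r) * (Pr r t - m' r) with hV'
  have hPP : Continuous fun p : ℝ × ℝ => P p.1 p.2 := hP
  have hPPr : Continuous fun p : ℝ × ℝ => Pr p.1 p.2 := hPr
  have hVd : ∀ r, HasDerivAt V (V' r) r := by
    intro r
    apply deriv_param _ _ (fun r t => (P r t - m r) ^ 2) (fun r t => 2 * (P r t - m r) * (Pr r t - m' r))
    · simp only [Function.uncurry_def]; fun_prop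
    · simp only [Function.uncurry_def]; fun_prop
    · intro r t
      exact (((hdr r t).sub (hmd r)).pow 2).congr_deriv (by simp)
  have hVc : Continuous V := continuous_iff_continuousAt.2 fun x => (hVd x).continuousAt
  have hVc' : Continuous V' := by
    apply intervalIntegral.continuous_parametric_intervalIntegral_of_continuous'
    simp only [Function.uncurry_def]; fun_prop
  have hV0 : V 0 = 0 := by
    have : m 0 = P0 := by
      simp only [hm, hP0, intervalIntegral.integral_const, smul_eq_mul]; field_simp; ring
    simp [hV, hP0, this]
  have hEc : Continuous fun r => ∫ t in (-π)..π, e r t :=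
    intervalIntegral.continuous_parametric_intervalIntegral_of_continuous' he _ _
  have hVnn : ∀ r, 0 ≤ V r := fun r => by
    apply intervalIntegral.integral_nonneg (by linarith)
    intro t _; positivity
  -- decomposition of the square
  have hdec : ∀ c r, ∫ t in (-π)..π, (P r t - c) ^ 2 = V r + 2 * π * (m r - c) ^ 2 := by
    intro c r
    have hc := sl P hP r
    have x1 : ∫ t in (-π)..π, (P r t - c) ^ 2 =
        ∫ t in (-π)..π, ((P r t - m r) ^ 2 + (2 * (m r - c) * P r t + (c ^ 2 - m r ^ 2))) := by
      congr 1; ext x; ring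
    rw [x1, intervalIntegral.integral_add (ii _ (by fun_prop)) (ii _ (by fun_prop)),
      intervalIntegral.integral_add (ii _ (by fun_prop)) (ii _ (by fun_prop)),
      intervalIntegral.integral_const_mul, hmI, intervalIntegral.integral_const, smul_eq_mul]
    simp only [hV]; ring
  have hen : ∀ r, 0 < r → r * ∫ t in (-π)..π, e r t =
      r * (2 * π * m' r ^ 2) + (∫ t in (-π)..π, r * (Pr r t - m' r) ^ 2) + 1 / r * ∫ t in (-π)..π, Pt r t ^ 2 := by
    intro r hr
    have hc1 := sl Pr hPr r
    have hc2 := sl Pt hPt r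
    rw [← intervalIntegral.integral_const_mul, ← intervalIntegral.integral_const_mul (1 / r)]
    have x1 : ∫ t in (-π)..π, r * e r t = ∫ t in (-π)..π, ((r * (Pr r t - m' r) ^ 2 + 1 / r * Pt r t ^ 2) +
        (2 * r * m' r * Pr r t + - r * m' r ^ 2)) := by
      congr 1; ext t
      have := hE r t
      field_simp
      rw [this]; ring
    rw [x1, intervalIntegral.integral_add (ii _ (by fun_prop)) (ii _ (by fun_prop)),
      intervalIntegral.integral_add (ii _ (by fun_prop)) (ii _ (by fun_prop)),
      intervalIntegral.integral_add (ii _ (by fun_prop)) (ii _ (by fun_prop)),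
      intervalIntegral.integral_const_mul (2 * r * m' r), hmI', intervalIntegral.integral_const, smul_eq_mul]
    ring
  refine ⟨m ε, ?_⟩
  intro W F F' A A' B B' hW hF hA hB hFR hA0 hBR
  have hR : 0 < R := hε.trans_le hεR
  have huI : Set.uIcc 0 R = Set.Icc 0 R := Set.uIcc_of_le hR.le
  -- angular inequality
  have hFc := hF.cont
  have hFc' := hF.2.1
  have key : ∀ r ∈ Set.Ioo 0 R, 2 * π * (r * m' r ^ 2) + ((F' r * V r + F r * V' r) + W r * r * V r) ≤
      r * ∫ t in (-π)..π, e r t := by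
    intro r hr
    have hr0 : 0 < r := hr.1
    rw [hen r hr0]
    have hc0 := sl P hP r
    have hc1 := sl Pr hPr r
    have hw := wirtinger (P r) (Pt r) (hdt r) (sl Pt hPt r) (hper r) (hper' r) (m r) (hmI r)
    have hw2 : 1 / r * V r ≤ 1 / r * ∫ t in (-π)..π, Pt r t ^ 2 :=
      mul_le_mul_of_nonneg_left hw (by positivity)
    have hmono : ∫ t in (-π)..π, ((F' r * (P r t - m r) ^ 2 + F r * (2 * (P r t - m r) * (Pr r t - m' r))) + W r * r * (P r t - m r) ^ 2)
      ≤ ∫ t in (-π)..π, (r * (Pr r t - m' r) ^ 2 + 1 / r * (P r t - m r) ^ 2) := by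
      apply intervalIntegral.integral_mono_on (by linarith) (ii _ (by fun_prop)) (ii _ (by fun_prop))
      intro t _
      have := ric_point (g := P r t - m r) (g' := Pr r t - m' r) hr0 (hF.2.2 r hr)
      have e2 : 1 * (P r t - m r) ^ 2 / r = 1 / r * (P r t - m r) ^ 2 := by ring
      linarith
    rw [intervalIntegral.integral_add (ii _ (by fun_prop)) (ii _ (by fun_prop)),
      intervalIntegral.integral_add (ii _ (by fun_prop)) (ii _ (by fun_prop)),
      intervalIntegral.integral_add (ii _ (by fun_prop)) (ii _ (by fun_prop)),
      intervalIntegral.integral_const_mul (F' r), intervalIntegral.integral_const_mul (F r),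
      intervalIntegral.integral_const_mul (W r * r), intervalIntegral.integral_const_mul (1 / r)] at hmono
    linarith
  have hD : ∀ x ∈ Set.uIcc 0 R, HasDerivAt (fun r => F r * V r) (F' x * V x + F x * V' x) x := by
    intro x hx
    rw [huI] at hx
    exact (hF.1 x hx).mul (hVd x)
  have hc1 : ContinuousOn (fun x => F' x * V x + F x * V' x) (Set.uIcc 0 R) := by
    rw [huI]; fun_prop
  have hc2 : ContinuousOn (fun x => W x * x * V x) (Set.uIcc 0 R) := by
    rw [huI]; fun_prop
  have hc3 : Continuous (fun r => 2 * π * (r * m' r ^ 2)) := by fun_prop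
  have hintg : ∫ r in (0:ℝ)..R, (2 * π * (r * m' r ^ 2) + ((F' r * V r + F r * V' r) + W r * r * V r)) ≤
      ∫ r in (0:ℝ)..R, r * ∫ t in (-π)..π, e r t := by
    apply intervalIntegral.integral_mono_on_of_le_Ioo hR.le
    · exact (hc3.continuousOn.add (hc1.add hc2)).intervalIntegrable
    · exact Continuous.intervalIntegrable (by fun_prop) _ _
    · exact key
  have hc12 : IntervalIntegrable (fun r => (F' r * V r + F r * V' r) + W r * r * V r) volume 0 R :=
    (hc1.add hc2).intervalIntegrable
  rw [intervalIntegral.integral_add (hc3.intervalIntegrable _ _) hc12,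
    intervalIntegral.integral_add hc1.intervalIntegrable hc2.intervalIntegrable,
    intervalIntegral.integral_eq_sub_of_hasDerivAt hD hc1.intervalIntegrable,
    intervalIntegral.integral_const_mul, hV0] at hintg
  -- radial inequality
  have r1 := ric0 (g := fun r => m r - m ε) (g' := m') hA le_rfl hε.le
    (hW.mono (Set.Icc_subset_Icc_right hεR)) (fun r => (hmd r).sub_const _) hmc'
  have r2 := ric0 (g := fun r => m r - m ε) (g' := m') hB hε.le hεR
    (hW.mono (Set.Icc_subset_Icc_left hε.le)) (fun r => (hmd r).sub_const _) hmc'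
  have hc4 : ContinuousOn (fun r => W r * r * (m r - m ε) ^ 2) (Set.Icc 0 R) := by fun_prop
  have i1 : IntervalIntegrable (fun r => W r * r * (m r - m ε) ^ 2) volume 0 ε := by
    apply ContinuousOn.intervalIntegrable
    rw [Set.uIcc_of_le hε.le]; exact hc4.mono (Set.Icc_subset_Icc_right hεR)
  have i2 : IntervalIntegrable (fun r => W r * r * (m r - m ε) ^ 2) volume ε R := by
    apply ContinuousOn.intervalIntegrable
    rw [Set.uIcc_of_le hεR]; exact hc4.mono (Set.Icc_subset_Icc_left hε.le)
  have r3 : ∫ r in (0:ℝ)..R, W r * r * (m r - m ε) ^ 2 ≤ ∫ r in (0:ℝ)..R, r * m' r ^ 2 := by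
    rw [← intervalIntegral.integral_add_adjacent_intervals i1 i2,
      ← intervalIntegral.integral_add_adjacent_intervals
        (Continuous.intervalIntegrable (by fun_prop) 0 ε) (Continuous.intervalIntegrable (by fun_prop) ε R)]
    simp only [sub_self] at r1 r2
    have := mul_nonneg hBR (sq_nonneg (m R - m ε))
    have := mul_nonneg (neg_nonneg.2 hA0) (sq_nonneg (m 0 - m ε))
    linarith
  have fin : ∫ r in (0:ℝ)..R, W r * r * ∫ t in (-π)..π, (P r t - m ε) ^ 2 =
      (∫ r in (0:ℝ)..R, W r * r * V r) + 2 * π * ∫ r in (0:ℝ)..R, W r * r * (m r - m ε) ^ 2 := by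
    rw [← intervalIntegral.integral_const_mul, ← intervalIntegral.integral_add hc2.intervalIntegrable]
    · congr 1; ext r; rw [hdec]; ring
    · exact (i1.trans i2).const_mul _
  rw [fin]
  have := mul_le_mul_of_nonneg_left r3 (by positivity : 0 ≤ 2 * π)
  have := mul_nonneg hFR (hVnn R)
  linarith

/-- scaling of Riccati data -/
lemma Ric.scale {q a b ε : ℝ} {W F F' : ℝ → ℝ} (hε : 0 < ε) (h : Ric q a b W F F') :
    Ric q (ε * a) (ε * b) (fun r => ε⁻¹ ^ 2 * W (r / ε)) (fun r => F (r / ε)) (fun r => F' (r / ε) / ε) := by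
  have hmap : Set.MapsTo (fun r => r / ε) (Set.Icc (ε * a) (ε * b)) (Set.Icc a b) := by
    intro r hr
    constructor
    · rw [le_div_iff₀ hε]; linarith [hr.1]
    · rw [div_le_iff₀ hε]; linarith [hr.2]
  refine ⟨?_, ?_, ?_⟩
  · intro r hr
    have h1 := h.1 _ (hmap hr)
    have h2 : HasDerivAt (fun r => r / ε) (1 / ε) r := (hasDerivAt_id r).div_const ε
    exact (h1.comp r h2).congr_deriv (by ring)
  · apply ContinuousOn.div_const
    exact h.2.1.comp (by fun_prop) hmap
  · intro r hr
    have h1 := h.2.2 (r / ε) ⟨by rw [lt_div_iff₀ hε]; linarith [hr.1], by rw [div_lt_iff₀ hε]; linarith [hr.2]⟩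
    have h2 := mul_le_mul_of_nonneg_left h1 (inv_pos.2 hε).le
    have e1 : ε⁻¹ * (F' (r / ε) + F (r / ε) ^ 2 / (r / ε)) = F' (r / ε) / ε + F (r / ε) ^ 2 / r := by
      field_simp
    have e2 : ε⁻¹ * (q / (r / ε) - W (r / ε) * (r / ε)) = q / r - ε⁻¹ ^ 2 * W (r / ε) * r := by
      field_simp
    rw [e1, e2] at h2
    exact h2

/-- angular Riccati supersolution -/
lemma ric_ang (R : ℝ) (hR : 8 ≤ R) : ∃ F F' : ℝ → ℝ,
    Ric 1 0 R (fun r => (8 - 48 / R ^ 2) / (1 + r ^ 2) ^ 2) F F' ∧ 0 ≤ F R := by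
  have hR0 : 0 < R := by linarith
  set κ : ℝ := 4 / R ^ 2 with hκ
  have hκ0 : 0 < κ := by positivity
  set b : ℝ → ℝ := fun r => 1 + κ * (r ^ 2 / 2 + Real.log (1 + r ^ 2)) with hb
  have hb1 : ∀ r, 1 ≤ b r := by
    intro r
    have h1 : 0 ≤ Real.log (1 + r ^ 2) := Real.log_nonneg (by nlinarith [sq_nonneg r])
    have : 0 ≤ κ * (r ^ 2 / 2 + Real.log (1 + r ^ 2)) := by positivity
    simp only [hb]; linarith
  have hb0 : ∀ r, b r ≠ 0 := fun r => by linarith [hb1 r]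
  have hp : ∀ r : ℝ, 1 + r ^ 2 ≠ 0 := fun r => by positivity
  have hbd : ∀ r, HasDerivAt b (κ * (r * (r ^ 2 + 3) / (1 + r ^ 2))) r := by
    intro r
    have h2 : HasDerivAt (fun r : ℝ => r ^ 2) (2 * r) r := by simpa using hasDerivAt_pow 2 r
    have h3 := (((h2.div_const 2).add ((h2.const_add 1).log (hp r))).const_mul κ).const_add 1
    refine h3.congr_deriv ?_
    have := hp r
    field_simp
    ring
  set N : ℝ → ℝ := fun r => κ * (r ^ 2 * (r ^ 2 + 3) / (1 + r ^ 2)) with hN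
  have hNd : ∀ r, HasDerivAt N (κ * (2 * r * (r ^ 4 + 2 * r ^ 2 + 3) / (1 + r ^ 2) ^ 2)) r := by
    intro r
    have h2 : HasDerivAt (fun r : ℝ => r ^ 2) (2 * r) r := by simpa using hasDerivAt_pow 2 r
    have h3 := (((h2.mul (h2.add_const 3)).div (h2.const_add 1) (hp r))).const_mul κ
    refine h3.congr_deriv ?_
    have := hp r
    simp only [Pi.mul_apply]
    field_simp
    ring
  have hF0 : ∀ r : ℝ, HasDerivAt (fun r : ℝ => (1 - r ^ 2) / (1 + r ^ 2)) (- 4 * r / (1 + r ^ 2) ^ 2) r := by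
    intro r
    have h2 : HasDerivAt (fun r : ℝ => r ^ 2) (2 * r) r := by simpa using hasDerivAt_pow 2 r
    refine ((h2.const_sub 1).div (h2.const_add 1) (hp r)).congr_deriv ?_
    have := hp r
    field_simp
    ring
  have hbc : Continuous b := continuous_iff_continuousAt.2 fun x => (hbd x).continuousAt
  refine ⟨fun r => (1 - r ^ 2) / (1 + r ^ 2) + N r / b r, fun r => - 4 * r / (1 + r ^ 2) ^ 2 +
    ((κ * (2 * r * (r ^ 4 + 2 * r ^ 2 + 3) / (1 + r ^ 2) ^ 2)) * b r -
      N r * (κ * (r * (r ^ 2 + 3) / (1 + r ^ 2)))) / b r ^ 2, ⟨?_, ?_, ?_⟩, ?_⟩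
  · intro r _
    exact (hF0 r).add ((hNd r).div (hbd r) (hb0 r))
  · apply Continuous.continuousOn
    simp only [hN]
    have := fun r => pow_ne_zero 2 (hp r)
    have := fun r => pow_ne_zero 2 (hb0 r)
    fun_prop (disch := assumption)
  · intro r hr
    have hr0 : 0 < r := hr.1
    have hpr := hp r
    have hbr := hb0 r
    have hb1r := hb1 r
    have e : - 4 * r / (1 + r ^ 2) ^ 2 +
      ((κ * (2 * r * (r ^ 4 + 2 * r ^ 2 + 3) / (1 + r ^ 2) ^ 2)) * b r -
      N r * (κ * (r * (r ^ 2 + 3) / (1 + r ^ 2)))) / b r ^ 2 + ((1 - r ^ 2) / (1 + r ^ 2) + N r / b r) ^ 2 / r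
      = 1 / r - 8 / (1 + r ^ 2) ^ 2 * r + 12 * κ * r / (1 + r ^ 2) ^ 2 / b r := by
      simp only [hN]
      generalize b r = β at hbr
      field_simp
      ring
    rw [e]
    have h1 : 12 * κ * r / (1 + r ^ 2) ^ 2 / b r ≤ 12 * κ * r / (1 + r ^ 2) ^ 2 :=
      div_le_self (by positivity) hb1r
    have h2 : (8 - 48 / R ^ 2) / (1 + r ^ 2) ^ 2 * r = 8 / (1 + r ^ 2) ^ 2 * r - 12 * κ * r / (1 + r ^ 2) ^ 2 := by
      simp only [hκ]; ring
    rw [h2]; linarith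
  · have hlog : Real.log (1 + R ^ 2) ≤ 2 * R := by
      have h1 : Real.log (1 + R ^ 2) ≤ Real.log ((1 + R) ^ 2) :=
        Real.log_le_log (by positivity) (by nlinarith)
      rw [Real.log_pow] at h1
      have h2 := Real.log_le_sub_one_of_pos (show 0 < 1 + R by linarith)
      push_cast at h1
      linarith
    have hbR : b R ≤ 4 := by
      have h1 : κ * Real.log (1 + R ^ 2) ≤ κ * (2 * R) := mul_le_mul_of_nonneg_left hlog hκ0.le
      have h2 : κ * (2 * R) = 8 / R := by simp only [hκ]; field_simp; ring
      have h3 : 8 / R ≤ 1 := by rw [div_le_one hR0]; exact hR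
      have h4 : κ * (R ^ 2 / 2) = 2 := by simp only [hκ]; field_simp; ring
      simp only [hb]
      linarith
    have hNR : N R = 4 * (R ^ 2 + 3) / (1 + R ^ 2) := by simp only [hN, hκ]; field_simp
    have h5 : (R ^ 2 + 3) / (1 + R ^ 2) ≤ N R / b R := by
      rw [hNR, le_div_iff₀ (by linarith [hb1 R])]
      have : (R ^ 2 + 3) / (1 + R ^ 2) * b R ≤ (R ^ 2 + 3) / (1 + R ^ 2) * 4 :=
        mul_le_mul_of_nonneg_left hbR (by positivity)
      linarith [show (R ^ 2 + 3) / (1 + R ^ 2) * 4 = 4 * (R ^ 2 + 3) / (1 + R ^ 2) by ring]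
    have h6 : (1 - R ^ 2) / (1 + R ^ 2) + (R ^ 2 + 3) / (1 + R ^ 2) = 4 / (1 + R ^ 2) := by ring
    have : 0 ≤ 4 / (1 + R ^ 2) := by positivity
    show 0 ≤ (1 - R ^ 2) / (1 + R ^ 2) + N R / b R
    linarith

lemma rho_aux (s : ℝ) (r : ℝ) (h : s ^ 2 - r ^ 4 ≠ 0) :
    HasDerivAt (fun r : ℝ => - (4 * s * r ^ 2 / (s ^ 2 - r ^ 4)))
      (- ((8 * s * r * (s ^ 2 - r ^ 4) + 4 * s * r ^ 2 * (4 * r ^ 3)) / (s ^ 2 - r ^ 4) ^ 2)) r := by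
  have h2 : HasDerivAt (fun r : ℝ => r ^ 2) (2 * r) r := by simpa using hasDerivAt_pow 2 r
  have h4 : HasDerivAt (fun r : ℝ => r ^ 4) (4 * r ^ 3) r := by simpa using hasDerivAt_pow 4 r
  exact ((h2.const_mul (4 * s)).div (h4.const_sub (s ^ 2)) h).neg.congr_deriv (by ring)

lemma rho_ric (s : ℝ) (hs : 0 < s) (l a b : ℝ) (ha : 0 ≤ a) (h : ∀ r ∈ Set.Icc a b, s ^ 2 - r ^ 4 ≠ 0)
    (hl : ∀ r ∈ Set.Icc a b, l / (1 + r ^ 2) ^ 2 ≤ 8 * s / (s + r ^ 2) ^ 2) : 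
    Ric 0 a b (fun r => l / (1 + r ^ 2) ^ 2) (fun r : ℝ => - (4 * s * r ^ 2 / (s ^ 2 - r ^ 4)))
      (fun r => - ((8 * s * r * (s ^ 2 - r ^ 4) + 4 * s * r ^ 2 * (4 * r ^ 3)) / (s ^ 2 - r ^ 4) ^ 2)) := by
  refine ⟨fun r hr => rho_aux s r (h r hr), ?_, ?_⟩
  · apply ContinuousOn.neg
    apply ContinuousOn.div (by fun_prop) (by fun_prop)
    intro r hr
    exact pow_ne_zero 2 (h r hr)
  · intro r hr
    have hr0 : 0 < r := lt_of_le_of_lt ha hr.1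
    have hr' := Set.Ioo_subset_Icc_self hr
    have h1 := h r hr'
    have h2 := mul_le_mul_of_nonneg_right (hl r hr') hr0.le
    have h3 : s + r ^ 2 ≠ 0 := by positivity
    have h4 : s - r ^ 2 ≠ 0 := by
      intro h5; apply h1
      have : s ^ 2 - r ^ 4 = (s - r ^ 2) * (s + r ^ 2) := by ring
      rw [this, h5, zero_mul]
    have e : - ((8 * s * r * (s ^ 2 - r ^ 4) + 4 * s * r ^ 2 * (4 * r ^ 3)) / (s ^ 2 - r ^ 4) ^ 2) +
        (- (4 * s * r ^ 2 / (s ^ 2 - r ^ 4))) ^ 2 / r = - (8 * s / (s + r ^ 2) ^ 2 * r) := by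
      have : s ^ 2 - r ^ 4 = (s - r ^ 2) * (s + r ^ 2) := by ring
      rw [this]
      field_simp
      ring
    rw [e, zero_div]
    linarith

lemma ric_in (l : ℝ) (h0 : 0 < l) (h8 : l < 8) : ∃ F F' : ℝ → ℝ,
    Ric 0 0 1 (fun r => l / (1 + r ^ 2) ^ 2) F F' ∧ F 0 ≤ 0 := by
  set s : ℝ := 8 / l with hs
  have hs1 : 1 < s := by rw [hs, lt_div_iff₀ h0]; linarith
  refine ⟨_, _, rho_ric s (by linarith) l 0 1 le_rfl ?_ ?_, ?_⟩
  · intro r hr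
    have : r ^ 4 ≤ 1 := pow_le_one₀ hr.1 hr.2
    nlinarith
  · intro r hr
    have hl : l = 8 / s := by rw [hs]; field_simp
    rw [hl, div_div, div_le_div_iff₀ (by positivity) (by positivity)]
    have : s + r ^ 2 ≤ s * (1 + r ^ 2) := by nlinarith [sq_nonneg r]
    have h2 : (s + r ^ 2) ^ 2 ≤ (s * (1 + r ^ 2)) ^ 2 := pow_le_pow_left₀ (by positivity) this 2
    nlinarith
  · simp

lemma ric_out (l R : ℝ) (h0 : 0 < l) (h8 : l < 8) (hR : 1 ≤ R) : ∃ F F' : ℝ → ℝ,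
    Ric 0 1 R (fun r => l / (1 + r ^ 2) ^ 2) F F' ∧ 0 ≤ F R := by
  set s : ℝ := l / 8 with hs
  have hs0 : 0 < s := by positivity
  have hs1 : s < 1 := by rw [hs]; linarith
  refine ⟨_, _, rho_ric s hs0 l 1 R zero_le_one ?_ ?_, ?_⟩
  · intro r hr
    have : 1 ≤ r ^ 4 := one_le_pow₀ hr.1
    nlinarith
  · intro r hr
    have hl : l = 8 * s := by rw [hs]; field_simp
    rw [hl]
    apply div_le_div_of_nonneg_left (by positivity) (by positivity)
    apply pow_le_pow_left₀ (by positivity)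
    linarith
  · have : 1 ≤ R ^ 4 := one_le_pow₀ hR
    have h1 : s ^ 2 - R ^ 4 ≤ 0 := by nlinarith
    have := div_nonpos_of_nonneg_of_nonpos (show 0 ≤ 4 * s * R ^ 2 by positivity) h1
    linarith

/-- data for the crude inequality -/
lemma ric_crude_in (R : ℝ) (hR : 1 ≤ R) : Ric 0 0 1 (fun _ => 1 / (4 * R ^ 3)) (fun r => - r ^ 2) (fun r => - (2 * r)) := by
  refine ⟨fun r _ => ?_, by fun_prop, ?_⟩
  · exact (hasDerivAt_pow 2 r).neg.congr_deriv (by simp)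
  · intro r hr
    have hr0 : 0 < r := hr.1
    have e : - (2 * r) + (- r ^ 2) ^ 2 / r = - (2 * r) + r ^ 3 := by field_simp
    rw [e, zero_div]
    have h1 : 1 / (4 * R ^ 3) ≤ 1 := by
      rw [div_le_one (by positivity)]
      have : 1 ≤ R ^ 3 := one_le_pow₀ hR
      linarith
    have h2 : 1 / (4 * R ^ 3) * r ≤ 1 * r := mul_le_mul_of_nonneg_right h1 hr0.le
    have h3 : r ^ 2 ≤ 1 := pow_le_one₀ hr0.le hr.2.le
    nlinarith

lemma ric_crude_out (R : ℝ) : Ric 0 1 R (fun _ => 1 / (4 * R ^ 3)) (fun r => 1 / 2 * r⁻¹)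
    (fun r => 1 / 2 * (- (r ^ 2)⁻¹)) := by
  refine ⟨fun r hr => ?_, ?_, ?_⟩
  · exact (hasDerivAt_inv (by linarith [hr.1] : r ≠ 0)).const_mul _
  · apply ContinuousOn.mul continuousOn_const
    apply ContinuousOn.neg
    apply ContinuousOn.inv₀ (by fun_prop)
    intro r hr
    have : 0 < r := by linarith [hr.1]
    positivity
  · intro r hr
    have hr1 : 1 < r := hr.1
    have hr0 : 0 < r := by linarith
    have e : 1 / 2 * (- (r ^ 2)⁻¹) + (1 / 2 * r⁻¹) ^ 2 / r = (1 - 2 * r) / (4 * r ^ 3) := by field_simp; ring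
    rw [e, zero_div, zero_sub]
    have h1 : 1 / (4 * R ^ 3) * r ≤ 1 / (4 * r ^ 3) * r := by
      apply mul_le_mul_of_nonneg_right _ hr0.le
      apply div_le_div_of_nonneg_left (by norm_num) (by positivity)
      have := pow_le_pow_left₀ hr0.le hr.2.le 3
      linarith
    have h2 : (1 - 2 * r) / (4 * r ^ 3) ≤ - (1 / (4 * r ^ 3) * r) := by
      rw [show - (1 / (4 * r ^ 3) * r) = (-r) / (4 * r ^ 3) by ring]
      apply div_le_div_of_nonneg_right _ (by positivity)
      linarith
    linarith

lemma ric_crude_ang (R : ℝ) (hR : 1 ≤ R) : Ric 1 0 R (fun _ => 1 / (4 * R ^ 3)) (fun _ => 0) (fun _ => 0) := by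
  refine ⟨fun r hr => hasDerivAt_const _ _, by fun_prop, ?_⟩
  intro r hr
  have hr0 : 0 < r := hr.1
  have : 1 / (4 * R ^ 3) * r ≤ 1 / r := by
    rw [div_mul_eq_mul_div, div_le_div_iff₀ (by positivity) hr0]
    have h1 : r ^ 2 ≤ R ^ 2 := pow_le_pow_left₀ hr0.le hr.2.le 2
    have h2 : R ^ 2 ≤ R ^ 3 := pow_le_pow_right₀ hR (by norm_num)
    nlinarith [sq_nonneg R]
  simp only [ne_eq, OfNat.ofNat_ne_zero, not_false_eq_true, zero_pow, zero_div, add_zero]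
  linarith

/-- closed disc in `ℝ × ℝ` -/
def Dsc (a : ℝ) : Set (ℝ × ℝ) := {p | p.1 ^ 2 + p.2 ^ 2 ≤ a ^ 2}

lemma Dsc_meas (a : ℝ) : MeasurableSet (Dsc a) :=
  (isClosed_le (by fun_prop) (by fun_prop)).measurableSet

lemma polar_disc (a : ℝ) (ha : 0 < a) (G : ℝ × ℝ → ℝ) (hG : Continuous G) :
    ∫ p in Dsc a, G p = ∫ r in (0:ℝ)..a, r * ∫ t in (-π)..π, G (r * cos t, r * sin t) := by
  have hpi := Real.pi_pos
  rw [← integral_indicator (Dsc_meas a), ← integral_comp_polarCoord_symm]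
  have h1 : ∀ p ∈ polarCoord.target, p.1 • (Dsc a).indicator G (polarCoord.symm p) =
      (Set.Ioc 0 a ×ˢ Set.Ioo (-π) π).indicator (fun p : ℝ × ℝ => p.1 * G (p.1 * cos p.2, p.1 * sin p.2)) p := by
    intro p hp
    rw [polarCoord_target] at hp
    rw [polarCoord_symm_apply, smul_eq_mul]
    have hp1 : 0 < p.1 := hp.1
    have hsq : (p.1 * cos p.2) ^ 2 + (p.1 * sin p.2) ^ 2 = p.1 ^ 2 := by
      nlinarith [sin_sq_add_cos_sq p.2]
    by_cases h : p.1 ≤ a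
    · rw [Set.indicator_of_mem, Set.indicator_of_mem]
      · exact ⟨⟨hp1, h⟩, hp.2⟩
      · show (p.1 * cos p.2) ^ 2 + (p.1 * sin p.2) ^ 2 ≤ a ^ 2
        rw [hsq]
        exact pow_le_pow_left₀ hp1.le h 2
    · rw [Set.indicator_of_notMem, Set.indicator_of_notMem, mul_zero]
      · intro h'; exact h h'.1.2
      · intro h'
        have h'' : (p.1 * cos p.2) ^ 2 + (p.1 * sin p.2) ^ 2 ≤ a ^ 2 := h'
        rw [hsq] at h''
        exact h (abs_le_of_sq_le_sq' h'' ha.le).2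
  rw [setIntegral_congr_fun polarCoord.open_target.measurableSet h1,
    setIntegral_indicator (measurableSet_Ioc.prod measurableSet_Ioo)]
  have h2 : polarCoord.target ∩ Set.Ioc 0 a ×ˢ Set.Ioo (-π) π = Set.Ioc 0 a ×ˢ Set.Ioo (-π) π := by
    apply Set.inter_eq_self_of_subset_right
    rw [polarCoord_target]
    exact Set.prod_mono (fun x hx => hx.1) le_rfl
  rw [h2, Measure.volume_eq_prod, setIntegral_prod, intervalIntegral.integral_of_le ha.le]
  · congr 1; ext r
    rw [integral_const_mul, intervalIntegral.integral_of_le (by linarith), integral_Ioc_eq_integral_Ioo]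
  · rw [← Measure.volume_eq_prod]
    have : IntegrableOn (fun p : ℝ × ℝ => p.1 * G (p.1 * cos p.2, p.1 * sin p.2)) (Set.Icc 0 a ×ˢ Set.Icc (-π) π) :=
      ContinuousOn.integrableOn_compact (isCompact_Icc.prod isCompact_Icc) (by fun_prop)
    exact this.mono_set (Set.prod_mono Set.Ioc_subset_Icc_self Set.Ioo_subset_Icc_self)

/-- `U` is a `C¹` function on the plane with partials `Ux`, `Uy`. -/
def HasPart (U Ux Uy : ℝ × ℝ → ℝ) : Prop :=
  Continuous Ux ∧ Continuous Uy ∧ 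
  ∀ p, HasFDerivAt U (Ux p • ContinuousLinearMap.fst ℝ ℝ ℝ + Uy p • ContinuousLinearMap.snd ℝ ℝ ℝ) p

lemma HasPart.cont {U Ux Uy : ℝ × ℝ → ℝ} (h : HasPart U Ux Uy) : Continuous U :=
  continuous_iff_continuousAt.2 fun p => (h.2.2 p).continuousAt

lemma HasPart.comp {U Ux Uy : ℝ × ℝ → ℝ} (h : HasPart U Ux Uy) {x y : ℝ → ℝ} {x' y' t : ℝ}
    (hx : HasDerivAt x x' t) (hy : HasDerivAt y y' t) :
    HasDerivAt (fun t => U (x t, y t)) (Ux (x t, y t) * x' + Uy (x t, y t) * y') t := by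
  have := (h.2.2 (x t, y t)).comp_hasDerivAt t (hx.prodMk hy)
  exact this.congr_deriv (by simp)

lemma disc_main (U Ux Uy : ℝ × ℝ → ℝ) (h : HasPart U Ux Uy) (α ε : ℝ) (hε : 0 < ε) (hεα : 8 * ε ≤ α) :
    ∃ c : ℝ, 
      ∫ p in Dsc α, (8 - 48 * ε ^ 2 / α ^ 2) * ε ^ 2 / (ε ^ 2 + (p.1 ^ 2 + p.2 ^ 2)) ^ 2 * (U p - c) ^ 2 ≤
        ∫ p in Dsc α, (Ux p ^ 2 + Uy p ^ 2) ∧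
      ε / (4 * α ^ 3) * ∫ p in Dsc α, (U p - c) ^ 2 ≤ ∫ p in Dsc α, (Ux p ^ 2 + Uy p ^ 2) := by
  have hα : 0 < α := by linarith
  have hUc := h.cont
  have hUx := h.1
  have hUy := h.2.1
  obtain ⟨c, hc⟩ := disc (fun r t => U (r * cos t, r * sin t))
    (fun r t => Ux (r * cos t, r * sin t) * cos t + Uy (r * cos t, r * sin t) * sin t)
    (fun r t => Ux (r * cos t, r * sin t) * (r * (- sin t)) + Uy (r * cos t, r * sin t) * (r * cos t))
    (fun r t => Ux (r * cos t, r * sin t) ^ 2 + Uy (r * cos t, r * sin t) ^ 2)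
    (by simp only [Function.uncurry_def]; fun_prop) (by simp only [Function.uncurry_def]; fun_prop)
    (by simp only [Function.uncurry_def]; fun_prop) (by simp only [Function.uncurry_def]; fun_prop)
    (fun r t => h.comp (by simpa using (hasDerivAt_id r).mul_const (cos t)) (by simpa using (hasDerivAt_id r).mul_const (sin t)))
    (fun r t => h.comp ((hasDerivAt_cos t).const_mul r) ((hasDerivAt_sin t).const_mul r))
    (by intro r t; simp) (by intro r t; simp) (U (0, 0)) (by intro t; simp)
    (by intro r t
        have := sin_sq_add_cos_sq t
        have h2 : cos t ^ 2 = 1 - sin t ^ 2 := by linarith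
        ring_nf
        rw [h2]
        ring)
    ε α hε (by linarith)
  refine ⟨c, ?_, ?_⟩
  · rw [polar_disc α hα, polar_disc α hα]
    · have hR : 8 ≤ α / ε := by rw [le_div_iff₀ hε]; exact hεα
      have hq : 48 / (α / ε) ^ 2 ≤ 48 / 8 ^ 2 := by
        apply div_le_div_of_nonneg_left (by norm_num) (by norm_num)
        exact pow_le_pow_left₀ (by norm_num) hR 2
      have hq' : 0 < 48 / (α / ε) ^ 2 := by positivity
      obtain ⟨F, F', hF, hFR⟩ := ric_ang (α / ε) hR
      obtain ⟨A, A', hA, hA0⟩ := ric_in (8 - 48 / (α / ε) ^ 2) (by linarith) (by linarith)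
      obtain ⟨B, B', hB, hBR⟩ := ric_out (8 - 48 / (α / ε) ^ 2) (α / ε) (by linarith) (by linarith) (by linarith)
      have e0 : ε * (α / ε) = α := by field_simp
      have hF2 := hF.scale hε
      have hA2 := hA.scale hε
      have hB2 := hB.scale hε
      rw [e0, mul_zero] at hF2
      rw [mul_zero, mul_one] at hA2
      rw [e0, mul_one] at hB2
      have := hc _ _ _ _ _ _ _ ?_ hF2 hA2 hB2 hFR (by simpa using hA0) hBR
      · refine le_trans (le_of_eq ?_) this
        congr 1; ext r
        rw [← intervalIntegral.integral_const_mul, ← intervalIntegral.integral_const_mul]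
        congr 1; ext t
        have hsq : (r * cos t) ^ 2 + (r * sin t) ^ 2 = r ^ 2 := by nlinarith [sin_sq_add_cos_sq t]
        simp only [hsq]
        have : ε ^ 2 + r ^ 2 ≠ 0 := by positivity
        have : 1 + (r / ε) ^ 2 ≠ 0 := by positivity
        field_simp
      · apply Continuous.continuousOn
        have : ∀ r : ℝ, (1 + (r / ε) ^ 2) ^ 2 ≠ 0 := fun r => by positivity
        fun_prop (disch := assumption)
    · fun_prop
    · have : ∀ p : ℝ × ℝ, (ε ^ 2 + (p.1 ^ 2 + p.2 ^ 2)) ^ 2 ≠ 0 := fun p => by positivity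
      fun_prop (disch := assumption)
  · rw [← integral_const_mul, polar_disc α hα, polar_disc α hα]
    · have hR : 1 ≤ α / ε := by rw [le_div_iff₀ hε]; linarith
      have hF := ric_crude_ang (α / ε) hR
      have hA := ric_crude_in (α / ε) hR
      have hB := ric_crude_out (α / ε)
      have e0 : ε * (α / ε) = α := by field_simp
      have hF2 := hF.scale hε
      have hA2 := hA.scale hε
      have hB2 := hB.scale hε
      rw [e0, mul_zero] at hF2
      rw [mul_zero, mul_one] at hA2
      rw [e0, mul_one] at hB2
      have := hc _ _ _ _ _ _ _ (by fun_prop) hF2 hA2 hB2 le_rfl (by simp) (by positivity)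
      refine le_trans (le_of_eq ?_) this
      congr 1; ext r
      rw [intervalIntegral.integral_const_mul]
      field_simp
    · fun_prop
    · fun_prop

/-- the plane as `EuclideanSpace` -/
noncomputable def toE (p : ℝ × ℝ) : EuclideanSpace ℝ (Fin 2) := !₂[p.1, p.2]

/-- centered fundamental square -/
def Qs : Set (ℝ × ℝ) := Set.Icc (-1/2) (1/2) ×ˢ Set.Icc (-1/2) (1/2)

lemma toE_cont : Continuous toE := by
  unfold toE; fun_prop

lemma toE_mp : MeasurePreserving toE := by
  have h1 := (PiLp.volume_preserving_toLp (Fin 2)).comp ((volume_preserving_finTwoArrow ℝ).symm)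
  exact h1

lemma toE_emb : MeasurableEmbedding toE := by
  have h1 := (MeasurableEquiv.toLp 2 (Fin 2 → ℝ)).measurableEmbedding.comp
    (MeasurableEquiv.finTwoArrow (α := ℝ)).symm.measurableEmbedding
  exact h1

lemma integral_unitSquare (f : EuclideanSpace ℝ (Fin 2) → ℝ) :
    ∫ x in unitSquare, f x = ∫ p in Set.Icc 0 1 ×ˢ Set.Icc 0 1, f (toE p) := by
  rw [← toE_mp.setIntegral_preimage_emb toE_emb]
  congr 2
  ext p
  simp [unitSquare, toE, Fin.forall_fin_two, Prod.le_def]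
  tauto

lemma integral_shift (G : ℝ × ℝ → ℝ) (hG : Continuous G) (h1 : ∀ x y, G (x + 1, y) = G (x, y))
    (h2 : ∀ x y, G (x, y + 1) = G (x, y)) :
    ∫ p in Set.Icc 0 1 ×ˢ Set.Icc 0 1, G p = ∫ p in Qs, G p := by
  have key : ∀ a b : ℝ, a ≤ b → ∫ p in Set.Icc a b ×ˢ Set.Icc a b, G p = ∫ x in a..b, ∫ y in a..b, G (x, y) := by
    intro a b hab
    rw [Measure.volume_eq_prod, setIntegral_prod, intervalIntegral.integral_of_le hab, integral_Icc_eq_integral_Ioc]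
    · congr 1; ext x
      rw [intervalIntegral.integral_of_le hab, integral_Icc_eq_integral_Ioc]
    · rw [← Measure.volume_eq_prod]
      exact ContinuousOn.integrableOn_compact (isCompact_Icc.prod isCompact_Icc) (by fun_prop)
  unfold Qs
  rw [key 0 1 (by norm_num), key (-1/2) (1/2) (by norm_num)]
  have e1 : ∀ x, ∫ y in (0:ℝ)..1, G (x, y) = ∫ y in (-1/2:ℝ)..(1/2), G (x, y) := by
    intro x
    have : Function.Periodic (fun y => G (x, y)) 1 := fun y => h2 x y
    have := this.intervalIntegral_add_eq 0 (-1/2)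
    norm_num at this ⊢
    exact this
  simp only [e1]
  have : Function.Periodic (fun x => ∫ y in (-1/2:ℝ)..(1/2), G (x, y)) 1 := fun x => by simp only [h1]
  have := this.intervalIntegral_add_eq 0 (-1/2)
  norm_num at this ⊢
  exact this

lemma toE_add0 (x y : ℝ) : toE (x + 1, y) = toE (x, y) + EuclideanSpace.single 0 1 := by
  ext i; fin_cases i <;> simp [toE]

lemma toE_add1 (x y : ℝ) : toE (x, y + 1) = toE (x, y) + EuclideanSpace.single 1 1 := by
  ext i; fin_cases i <;> simp [toE]

lemma toE_surj (x : EuclideanSpace ℝ (Fin 2)) : toE (x 0, x 1) = x := by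
  ext i; fin_cases i <;> simp [toE]

lemma integral_sq (f : EuclideanSpace ℝ (Fin 2) → ℝ) (hf : Continuous f) (hp : ZsqPeriodic f) :
    ∫ x in unitSquare, f x = ∫ p in Qs, f (toE p) := by
  rw [integral_unitSquare, integral_shift]
  · exact hf.comp toE_cont
  · intro x y; rw [toE_add0, hp]
  · intro x y; rw [toE_add1, hp]

lemma latticeDist_Q (p : ℝ × ℝ) (hp : p ∈ Qs) : latticeDist (toE p) = √(p.1 ^ 2 + p.2 ^ 2) := by
  unfold latticeDist
  have h0 : (0 : EuclideanSpace ℝ (Fin 2)) ∈ {y : EuclideanSpace ℝ (Fin 2) | ∀ i : Fin 2, ∃ m : ℤ, y i = (m : ℝ)} := by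
    intro i; exact ⟨0, by simp⟩
  have hintg : ∀ (t : ℝ) (m : ℤ), t ∈ Set.Icc (-1/2 : ℝ) (1/2) → t ^ 2 ≤ (t - m) ^ 2 := by
    intro t m ht
    have hm : (0:ℝ) ≤ m * (m - 2 * t) := by
      rcases lt_trichotomy m 0 with h | h | h
      · have : (m:ℝ) ≤ -1 := by exact_mod_cast Int.le_sub_one_of_lt h
        nlinarith [ht.1, ht.2]
      · simp [h]
      · have : (1:ℝ) ≤ m := by exact_mod_cast h
        nlinarith [ht.1, ht.2]
    nlinarith
  apply le_antisymm
  · refine (Metric.infDist_le_dist_of_mem h0).trans (le_of_eq ?_)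
    rw [dist_zero_right, EuclideanSpace.norm_eq]
    simp [toE]
  · rw [Metric.le_infDist ⟨0, h0⟩]
    intro y hy
    rw [EuclideanSpace.dist_eq]
    apply Real.sqrt_le_sqrt
    obtain ⟨a, ha⟩ := hy 0
    obtain ⟨b, hb⟩ := hy 1
    simp only [Fin.sum_univ_two, Real.dist_eq, sq_abs, ha, hb, toE]
    have := hintg p.1 a hp.1
    have := hintg p.2 b hp.2
    simp
    linarith

lemma latticeDist_cont : Continuous latticeDist := Metric.continuous_infDist_pt _

lemma latticeDist_nonneg (x) : 0 ≤ latticeDist x := Metric.infDist_nonneg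

lemma latticeDist_le (x) : latticeDist x ≤ ‖x‖ := by
  unfold latticeDist
  refine (Metric.infDist_le_dist_of_mem (y := 0) ?_).trans (le_of_eq (dist_zero_right _))
  intro i; exact ⟨0, by simp⟩

lemma latticeDist_per : ZsqPeriodic latticeDist := by
  intro x i
  unfold latticeDist
  set S := {y : EuclideanSpace ℝ (Fin 2) | ∀ i : Fin 2, ∃ m : ℤ, y i = (m : ℝ)} with hS
  have h := Metric.infDist_image (Φ := fun y => y + EuclideanSpace.single i (1:ℝ)) (isometry_add_right _) (x := x) (t := S)
  have h2 : (fun y => y + EuclideanSpace.single i (1:ℝ)) '' S = S := by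
    ext y
    simp only [Set.mem_image, hS, Set.mem_ofPred_eq]
    constructor
    · rintro ⟨z, hz, rfl⟩ j
      obtain ⟨m, hm⟩ := hz j
      by_cases hij : j = i
      · exact ⟨m + 1, by simp [hij]; subst hij; exact hm⟩
      · exact ⟨m, by simp [hm, hij]⟩
    · intro hy
      refine ⟨y - EuclideanSpace.single i (1:ℝ), fun j => ?_, by simp⟩
      obtain ⟨m, hm⟩ := hy j
      by_cases hij : j = i
      · exact ⟨m - 1, by simp [hij]; subst hij; exact hm⟩
      · exact ⟨m, by simp [hm, hij]⟩
  rw [h2] at h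
  exact h

lemma fae_cont (α ε : ℝ) (hε : 0 < ε) : Continuous (fae α ε) := by
  unfold fae
  have := latticeDist_cont
  have : ∀ x, ε ^ 2 + (min (latticeDist x) α) ^ 2 ≠ 0 := fun x => by positivity
  fun_prop (disch := assumption)

lemma fae_pos (α ε : ℝ) (hε : 0 < ε) (x) : 0 < fae α ε x := by
  unfold fae; positivity

lemma fae_per (α ε : ℝ) : ZsqPeriodic (fae α ε) := by
  intro x i
  unfold fae
  rw [latticeDist_per x i]

lemma fae_in (α ε : ℝ) (hα : 0 < α) (p : ℝ × ℝ) (hp : p ∈ Qs) (hd : p ∈ Dsc α) :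
    fae α ε (toE p) = ε ^ 2 / (ε ^ 2 + (p.1 ^ 2 + p.2 ^ 2)) := by
  unfold fae
  rw [latticeDist_Q p hp, min_eq_left, Real.sq_sqrt (by positivity)]
  exact Real.sqrt_le_iff.2 ⟨hα.le, hd⟩

lemma fae_out (α ε : ℝ) (p : ℝ × ℝ) (hp : p ∈ Qs) (hd : p ∉ Dsc α) :
    fae α ε (toE p) = ε ^ 2 / (ε ^ 2 + α ^ 2) := by
  unfold fae
  rw [latticeDist_Q p hp, min_eq_right]
  apply Real.le_sqrt_of_sq_le
  have : ¬ (p.1 ^ 2 + p.2 ^ 2 ≤ α ^ 2) := hd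
  linarith

lemma Dsc_sub (α : ℝ) (hα0 : 0 < α) (hα : α < 1 / 2) : Dsc α ⊆ Qs := by
  intro p hp
  have hp' : p.1 ^ 2 + p.2 ^ 2 ≤ α ^ 2 := hp
  have h1 := abs_le_of_sq_le_sq' (show p.1 ^ 2 ≤ α ^ 2 by nlinarith [sq_nonneg p.2]) hα0.le
  have h2 := abs_le_of_sq_le_sq' (show p.2 ^ 2 ≤ α ^ 2 by nlinarith [sq_nonneg p.1]) hα0.le
  exact ⟨⟨by linarith, by linarith⟩, ⟨by linarith, by linarith⟩⟩

lemma Qs_compact : IsCompact Qs := isCompact_Icc.prod isCompact_Icc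
lemma Qs_meas : MeasurableSet Qs := measurableSet_Icc.prod measurableSet_Icc

lemma Qs_integrable {G : ℝ × ℝ → ℝ} (hG : Continuous G) : IntegrableOn G Qs :=
  ContinuousOn.integrableOn_compact Qs_compact (by fun_prop)

lemma hasPart_of_contDiff (u : EuclideanSpace ℝ (Fin 2) → ℝ) (hu : ContDiff ℝ (⊤ : ℕ∞) u) :
    ∃ Ux Uy : ℝ × ℝ → ℝ, HasPart (fun p => u (toE p)) Ux Uy ∧
      ∀ p, ‖gradient u (toE p)‖ ^ 2 = Ux p ^ 2 + Uy p ^ 2 := by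
  have hfc : Continuous (fderiv ℝ u) := hu.continuous_fderiv (by simp)
  refine ⟨fun p => fderiv ℝ u (toE p) (EuclideanSpace.single 0 1),
    fun p => fderiv ℝ u (toE p) (EuclideanSpace.single 1 1), ⟨?_, ?_, ?_⟩, ?_⟩
  · have := toE_cont; fun_prop
  · have := toE_cont; fun_prop
  · intro p
    have h1 : HasFDerivAt u (fderiv ℝ u (toE p)) (toE p) := (hu.differentiable (by simp) _).hasFDerivAt
    let L : ℝ × ℝ →L[ℝ] EuclideanSpace ℝ (Fin 2) :=
      (ContinuousLinearMap.fst ℝ ℝ ℝ).smulRight (EuclideanSpace.single 0 (1:ℝ)) +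
      (ContinuousLinearMap.snd ℝ ℝ ℝ).smulRight (EuclideanSpace.single 1 (1:ℝ))
    have hL : ∀ q, toE q = L q := by
      intro q; ext i; fin_cases i <;> simp [toE, L]
    have h2 : HasFDerivAt toE L p := by
      have : toE = L := funext hL
      rw [this]; exact L.hasFDerivAt
    refine (h1.comp p h2).congr_fderiv ?_
    ext <;> simp [L]
  · intro p
    have hc : ∀ i, (gradient u (toE p)) i = fderiv ℝ u (toE p) (EuclideanSpace.single i 1) := by
      intro i
      have h1 : fderiv ℝ u (toE p) (EuclideanSpace.single i 1) = inner ℝ (gradient u (toE p)) (EuclideanSpace.single i 1) := by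
        unfold gradient
        rw [InnerProductSpace.toDual_symm_apply]
      rw [h1, EuclideanSpace.inner_single_right]
      simp
    rw [EuclideanSpace.norm_sq_eq, Fin.sum_univ_two, hc, hc]
    simp [sq_abs]

lemma Qs_iter (G : ℝ × ℝ → ℝ) (hG : Continuous G) :
    ∫ p in Qs, G p = ∫ x in (-1/2:ℝ)..(1/2), ∫ y in (-1/2:ℝ)..(1/2), G (x, y) := by
  unfold Qs
  rw [Measure.volume_eq_prod, setIntegral_prod, intervalIntegral.integral_of_le (by norm_num), integral_Icc_eq_integral_Ioc]
  · congr 1; ext x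
    rw [intervalIntegral.integral_of_le (by norm_num), integral_Icc_eq_integral_Ioc]
  · rw [← Measure.volume_eq_prod]
    exact Qs_integrable hG

lemma Qs_swap (G : ℝ × ℝ → ℝ) : ∫ p in Qs, G p.swap = ∫ p in Qs, G p := by
  unfold Qs
  rw [Measure.volume_eq_prod, setIntegral_prod_swap]

lemma Qs_iter' (G : ℝ × ℝ → ℝ) (hG : Continuous G) :
    ∫ p in Qs, G p = ∫ y in (-1/2:ℝ)..(1/2), ∫ x in (-1/2:ℝ)..(1/2), G (x, y) := by
  rw [← Qs_swap, Qs_iter _ (by fun_prop)]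
  rfl

lemma Qs_vol : ∫ _p in Qs, (1:ℝ) = 1 := by
  rw [Qs_iter (fun _ => 1) continuous_const]; norm_num

lemma cs_1d (g g' : ℝ → ℝ) (hg : ∀ x, HasDerivAt g (g' x) x) (hg' : Continuous g') (x x' : ℝ)
    (hx : x ∈ Set.Icc (-1/2:ℝ) (1/2)) (hx' : x' ∈ Set.Icc (-1/2:ℝ) (1/2)) :
    (g x - g x') ^ 2 ≤ ∫ s in (-1/2:ℝ)..(1/2), g' s ^ 2 := by
  have ii : ∀ f : ℝ → ℝ, Continuous f → ∀ a b, IntervalIntegrable f volume a b :=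
    fun f hf a b => hf.intervalIntegrable a b
  have main : ∀ a ∈ Set.Icc (-1/2:ℝ) (1/2), ∀ b ∈ Set.Icc (-1/2:ℝ) (1/2), a ≤ b → 
      (g b - g a) ^ 2 ≤ ∫ s in (-1/2:ℝ)..(1/2), g' s ^ 2 := by
    intro a ha b hb hab
    set k := ∫ s in (-1/2:ℝ)..(1/2), |g' s| with hk
    have h1 : |g b - g a| ≤ k := by
      rw [← intervalIntegral.integral_eq_sub_of_hasDerivAt (fun x _ => hg x) (ii _ hg' a b)]
      refine (intervalIntegral.abs_integral_le_integral_abs hab).trans ?_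
      apply intervalIntegral.integral_mono_interval ha.1 hab hb.2
      · exact Eventually.of_forall fun s => abs_nonneg _
      · exact ii _ (by fun_prop) _ _
    have h2 : (g b - g a) ^ 2 ≤ k ^ 2 := by
      rw [← sq_abs]; exact pow_le_pow_left₀ (abs_nonneg _) h1 2
    have h3 : 0 ≤ ∫ s in (-1/2:ℝ)..(1/2), (|g' s| - k) ^ 2 := by
      apply intervalIntegral.integral_nonneg (by norm_num)
      intro s _; positivity
    have h4 : ∫ s in (-1/2:ℝ)..(1/2), (|g' s| - k) ^ 2 = ∫ s in (-1/2:ℝ)..(1/2), (g' s ^ 2 + (-2 * k * |g' s| + k ^ 2)) := by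
      congr 1; ext s; rw [← sq_abs (g' s)]; ring
    rw [h4, intervalIntegral.integral_add (ii _ (by fun_prop) _ _) (ii _ (by fun_prop) _ _),
      intervalIntegral.integral_add (ii _ (by fun_prop) _ _) (ii _ (by fun_prop) _ _),
      intervalIntegral.integral_const_mul, ← hk, intervalIntegral.integral_const, smul_eq_mul] at h3
    norm_num at h3 h2 ⊢
    nlinarith
  rcases le_total x' x with h | h
  · exact main _ hx' _ hx h
  · have := main _ hx _ hx' h
    nlinarith

lemma Dsc_vol (α : ℝ) (hα : 0 < α) : ∫ _p in Dsc α, (1:ℝ) = π * α ^ 2 := by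
  rw [polar_disc α hα (fun _ => 1) continuous_const]
  simp
  ring

lemma poincare (U Ux Uy : ℝ × ℝ → ℝ) (h : HasPart U Ux Uy) (α : ℝ) (hα0 : 0 < α) (hα : α < 1 / 2) (c : ℝ) :
    π * α ^ 2 * ∫ p in Qs, (U p - c) ^ 2 ≤ (3 * π * α ^ 2 + 3) * (∫ p in Qs, (Ux p ^ 2 + Uy p ^ 2)) +
      3 * ∫ p in Dsc α, (U p - c) ^ 2 := by
  have hUc := h.cont
  have hUx := h.1
  have hUy := h.2.1
  set a : ℝ → ℝ := fun y => ∫ s in (-1/2:ℝ)..(1/2), Ux (s, y) ^ 2 with ha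
  set b : ℝ → ℝ := fun x => ∫ s in (-1/2:ℝ)..(1/2), Uy (x, s) ^ 2 with hb
  have hac : Continuous a := by
    apply intervalIntegral.continuous_parametric_intervalIntegral_of_continuous'
    simp only [Function.uncurry_def]; fun_prop
  have hbc : Continuous b := by
    apply intervalIntegral.continuous_parametric_intervalIntegral_of_continuous'
    simp only [Function.uncurry_def]; fun_prop
  have hb0 : ∀ x, 0 ≤ b x := fun x => intervalIntegral.integral_nonneg (by norm_num) fun s _ => by positivity
  have ha1 : ∫ p in Qs, a p.2 = ∫ p in Qs, Ux p ^ 2 := by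
    rw [Qs_iter' _ (by fun_prop), Qs_iter' (fun p => Ux p ^ 2) (by fun_prop)]
    congr 1; ext y; simp only [intervalIntegral.integral_const, ha, smul_eq_mul]; norm_num
  have hb1 : ∫ p in Qs, b p.1 = ∫ p in Qs, Uy p ^ 2 := by
    rw [Qs_iter _ (by fun_prop), Qs_iter (fun p => Uy p ^ 2) (by fun_prop)]
    congr 1; ext y; simp only [intervalIntegral.integral_const, hb, smul_eq_mul]; norm_num
  have hsub := Dsc_sub α hα0 hα
  have id : ∀ {G : ℝ × ℝ → ℝ}, Continuous G → IntegrableOn G (Dsc α) := fun hG => (Qs_integrable hG).mono_set hsub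
  have pt : ∀ p ∈ Qs, ∀ q ∈ Qs, (U p - c) ^ 2 ≤ 3 * a p.2 + (3 * b q.1 + 3 * (U q - c) ^ 2) := by
    intro p hp q hq
    have h1 := cs_1d (fun x => U (x, p.2)) (fun x => Ux (x, p.2)) (fun x => (h.comp (hasDerivAt_id x) (hasDerivAt_const x p.2)).congr_deriv (by simp))
      (by fun_prop) p.1 q.1 hp.1 hq.1
    have h2 := cs_1d (fun y => U (q.1, y)) (fun y => Uy (q.1, y)) (fun y => (h.comp (hasDerivAt_const y q.1) (hasDerivAt_id y)).congr_deriv (by simp))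
      (by fun_prop) p.2 q.2 hp.2 hq.2
    change (U p - U (q.1, p.2)) ^ 2 ≤ a p.2 at h1
    change (U (q.1, p.2) - U q) ^ 2 ≤ b q.1 at h2
    nlinarith [sq_nonneg ((U p - U (q.1, p.2)) - (U (q.1, p.2) - U q)), sq_nonneg ((U p - U (q.1, p.2)) - (U q - c)),
      sq_nonneg ((U (q.1, p.2) - U q) - (U q - c))]
  have st1 : ∀ p ∈ Qs, π * α ^ 2 * (U p - c) ^ 2 ≤ π * α ^ 2 * (3 * a p.2) + (3 * (∫ q in Qs, Uy q ^ 2) + 3 * ∫ q in Dsc α, (U q - c) ^ 2) := by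
    intro p hp
    have h1 : ∫ q in Dsc α, (U p - c) ^ 2 * 1 ≤ ∫ q in Dsc α, (3 * a p.2 * 1 + (3 * b q.1 + 3 * (U q - c) ^ 2)) := by
      apply setIntegral_mono_on (id (by fun_prop)) (id (by fun_prop)) (Dsc_meas α)
      intro q hq
      have := pt p hp q (hsub hq)
      linarith
    rw [integral_add (id (by fun_prop)) (id (by fun_prop)), integral_add (id (by fun_prop)) (id (by fun_prop)),
      integral_const_mul, integral_const_mul, integral_const_mul, integral_const_mul, Dsc_vol α hα0] at h1
    have h2 : ∫ q in Dsc α, b q.1 ≤ ∫ q in Qs, b q.1 := by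
      apply setIntegral_mono_set (Qs_integrable (by fun_prop)) (Eventually.of_forall fun q => hb0 _)
      exact hsub.eventuallyLE
    linarith
  have st2 : ∫ p in Qs, π * α ^ 2 * (U p - c) ^ 2 ≤ ∫ p in Qs, (π * α ^ 2 * (3 * a p.2) + (3 * (∫ q in Qs, Uy q ^ 2) + 3 * ∫ q in Dsc α, (U q - c) ^ 2) * 1) := by
    apply setIntegral_mono_on (Qs_integrable (by fun_prop)) (Qs_integrable (by fun_prop)) Qs_meas
    intro p hp
    have := st1 p hp
    linarith
  rw [integral_add (Qs_integrable (by fun_prop)) (Qs_integrable (by fun_prop)), integral_const_mul, integral_const_mul,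
    integral_const_mul, integral_const_mul, Qs_vol, ha1] at st2
  rw [integral_add (Qs_integrable (by fun_prop)) (Qs_integrable (by fun_prop))]
  have p1 : 0 ≤ ∫ p in Qs, Ux p ^ 2 := integral_nonneg fun p => by positivity
  have p2 : 0 ≤ ∫ p in Qs, Uy p ^ 2 := integral_nonneg fun p => by positivity
  have p3 : 0 ≤ π * α ^ 2 * ∫ p in Qs, Uy p ^ 2 := by positivity
  nlinarith

/-- The constant in the eigenvalue bound. -/
noncomputable def Kc (α ε : ℝ) : ℝ :=
  ε ^ 2 / (8 - 48 * ε ^ 2 / α ^ 2) + ε ^ 4 / α ^ 4 * ((3 * π * α ^ 2 + 3 + 3 * (4 * α ^ 3 / ε)) / (π * α ^ 2))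

lemma core (U Ux Uy H : ℝ × ℝ → ℝ) (h : HasPart U Ux Uy) (hH : Continuous H) (α ε : ℝ) (hα0 : 0 < α) (hα : α < 1 / 2)
    (hε : 0 < ε) (hεα : 8 * ε ≤ α) (hin : ∀ p ∈ Qs, p ∈ Dsc α → H p = ε ^ 2 / (ε ^ 2 + (p.1 ^ 2 + p.2 ^ 2)))
    (hout : ∀ p ∈ Qs, p ∉ Dsc α → H p = ε ^ 2 / (ε ^ 2 + α ^ 2)) (hmean : ∫ p in Qs, U p * H p ^ 2 = 0) :
    ∫ p in Qs, U p ^ 2 * H p ^ 2 ≤ Kc α ε * ∫ p in Qs, (Ux p ^ 2 + Uy p ^ 2) := by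
  have hUc := h.cont
  have hUx := h.1
  have hUy := h.2.1
  have hpi := Real.pi_pos
  obtain ⟨c, h1, h2⟩ := disc_main U Ux Uy h α ε hε hεα
  have h3 := poincare U Ux Uy h α hα0 hα c
  have hsub := Dsc_sub α hα0 hα
  set D := ∫ p in Qs, (Ux p ^ 2 + Uy p ^ 2) with hD
  have hDle : ∫ p in Dsc α, (Ux p ^ 2 + Uy p ^ 2) ≤ D := by
    apply setIntegral_mono_set (Qs_integrable (by fun_prop)) (Eventually.of_forall fun q => ?_) hsub.eventuallyLE
    show 0 ≤ Ux q ^ 2 + Uy q ^ 2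
    positivity
  have hl : 0 < 8 - 48 * ε ^ 2 / α ^ 2 := by
    have : 48 * ε ^ 2 / α ^ 2 ≤ 1 := by
      rw [div_le_one (by positivity)]; nlinarith
    linarith
  set l := 8 - 48 * ε ^ 2 / α ^ 2 with hldef
  -- subtracting the constant
  have s1 : ∫ p in Qs, U p ^ 2 * H p ^ 2 ≤ ∫ p in Qs, (U p - c) ^ 2 * H p ^ 2 := by
    have e : ∫ p in Qs, (U p - c) ^ 2 * H p ^ 2 = ∫ p in Qs, (U p ^ 2 * H p ^ 2 + (-2 * c * (U p * H p ^ 2) + c ^ 2 * H p ^ 2)) := by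
      congr 1; ext p; ring
    rw [e, integral_add (Qs_integrable (by fun_prop)) (Qs_integrable (by fun_prop)),
      integral_add (Qs_integrable (by fun_prop)) (Qs_integrable (by fun_prop)), integral_const_mul, hmean]
    have : 0 ≤ ∫ p in Qs, c ^ 2 * H p ^ 2 := integral_nonneg fun p => by positivity
    linarith
  have s2 : ∫ p in Qs, (U p - c) ^ 2 * H p ^ 2 = (∫ p in Dsc α, (U p - c) ^ 2 * H p ^ 2) + ∫ p in Qs \ Dsc α, (U p - c) ^ 2 * H p ^ 2 := by
    rw [add_comm, setIntegral_sdiff (Dsc_meas α) (Qs_integrable (by fun_prop)) hsub]; ring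
  have s3 : ∫ p in Dsc α, (U p - c) ^ 2 * H p ^ 2 ≤ ε ^ 2 / l * D := by
    have e : ∫ p in Dsc α, (U p - c) ^ 2 * H p ^ 2 = ε ^ 2 / l * ∫ p in Dsc α, l * ε ^ 2 / (ε ^ 2 + (p.1 ^ 2 + p.2 ^ 2)) ^ 2 * (U p - c) ^ 2 := by
      rw [← integral_const_mul]
      apply setIntegral_congr_fun (Dsc_meas α)
      intro p hp
      simp only [hin p (hsub hp) hp]
      have : ε ^ 2 + (p.1 ^ 2 + p.2 ^ 2) ≠ 0 := by positivity
      field_simp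
    rw [e]
    exact mul_le_mul_of_nonneg_left (h1.trans hDle) (by positivity)
  have s4 : ∫ p in Qs \ Dsc α, (U p - c) ^ 2 * H p ^ 2 ≤ ε ^ 4 / α ^ 4 * ∫ p in Qs, (U p - c) ^ 2 := by
    rw [← integral_const_mul]
    have e : ∫ p in Qs \ Dsc α, (U p - c) ^ 2 * H p ^ 2 ≤ ∫ p in Qs \ Dsc α, ε ^ 4 / α ^ 4 * (U p - c) ^ 2 := by
      apply setIntegral_mono_on
      · exact (Qs_integrable (by fun_prop)).mono_set Set.sdiff_subset
      · exact (Qs_integrable (by fun_prop)).mono_set Set.sdiff_subset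
      · exact Qs_meas.diff (Dsc_meas α)
      · intro p hp
        rw [hout p hp.1 hp.2, mul_comm]
        apply mul_le_mul_of_nonneg_right _ (sq_nonneg _)
        rw [div_pow, ← pow_mul, show (2 * 2 : ℕ) = 4 from rfl]
        apply div_le_div_of_nonneg_left (by positivity) (by positivity)
        nlinarith [sq_nonneg ε, sq_nonneg α, mul_nonneg (sq_nonneg ε) (sq_nonneg α), sq_nonneg (ε ^ 2)]
    refine e.trans ?_
    apply setIntegral_mono_set (Qs_integrable (by fun_prop)) (Eventually.of_forall fun q => ?_) Set.sdiff_subset.eventuallyLE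
    show 0 ≤ ε ^ 4 / α ^ 4 * (U q - c) ^ 2
    positivity
  have s5 : ∫ p in Dsc α, (U p - c) ^ 2 ≤ 4 * α ^ 3 / ε * D := by
    have := mul_le_mul_of_nonneg_left (h2.trans hDle) (show 0 ≤ 4 * α ^ 3 / ε by positivity)
    rw [← mul_assoc] at this
    have e : 4 * α ^ 3 / ε * (ε / (4 * α ^ 3)) = 1 := by field_simp
    rwa [e, one_mul] at this
  have s6 : ∫ p in Qs, (U p - c) ^ 2 ≤ ((3 * π * α ^ 2 + 3 + 3 * (4 * α ^ 3 / ε)) / (π * α ^ 2)) * D := by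
    rw [div_mul_eq_mul_div, le_div_iff₀ (by positivity)]
    linarith
  have s7 := mul_le_mul_of_nonneg_left s6 (show 0 ≤ ε ^ 4 / α ^ 4 by positivity)
  unfold Kc
  rw [← hldef, add_mul, mul_assoc]
  linarith

lemma per_round (u : EuclideanSpace ℝ (Fin 2) → ℝ) (hp : ZsqPeriodic u) (a b : ℝ) :
    u (toE (a - round a, b - round b)) = u (toE (a, b)) := by
  have h1 : ∀ y, Function.Periodic (fun x => u (toE (x, y))) 1 := by
    intro y x
    simp only [toE_add0, hp _ 0]
  have h2 : ∀ x, Function.Periodic (fun y => u (toE (x, y))) 1 := by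
    intro x y
    simp only [toE_add1, hp _ 1]
  have e1 := (h1 (b - round b)).sub_int_mul_eq (x := a) (round a)
  have e2 := (h2 a).sub_int_mul_eq (x := b) (round b)
  simp only [mul_one] at e1 e2
  rw [e1, e2]

lemma round_mem_Qs (a b : ℝ) : ((a - round a, b - round b) : ℝ × ℝ) ∈ Qs := by
  have h1 := abs_le.1 (abs_sub_round a)
  have h2 := abs_le.1 (abs_sub_round b)
  unfold Qs
  refine Set.mk_mem_prod ⟨?_, ?_⟩ ⟨?_, ?_⟩ <;> linarith [h1.1, h1.2, h2.1, h2.2]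

lemma den_pos (u h : EuclideanSpace ℝ (Fin 2) → ℝ) (hu : Continuous u) (hh : Continuous h)
    (hp : ZsqPeriodic u) (hpos : ∀ x, 0 < h x) (hne : u ≠ 0) :
    0 < ∫ p in Qs, u (toE p) ^ 2 * h (toE p) ^ 2 := by
  have hc : Continuous fun p => u (toE p) ^ 2 * h (toE p) ^ 2 := by
    have := toE_cont
    fun_prop
  have h0 : 0 ≤ ∫ p in Qs, u (toE p) ^ 2 * h (toE p) ^ 2 := integral_nonneg fun p => by positivity
  refine lt_of_le_of_ne h0 fun heq => hne ?_
  have h1 := (setIntegral_eq_zero_iff_of_nonneg_ae (Eventually.of_forall fun p => by positivity)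
    (Qs_integrable hc)).1 heq.symm
  have h2 : Set.EqOn (fun p => u (toE p) ^ 2 * h (toE p) ^ 2) 0 Qs := by
    apply Measure.eqOn_of_ae_eq h1 hc.continuousOn continuousOn_const
    unfold Qs
    rw [interior_prod_eq, closure_prod_eq, interior_Icc, closure_Ioo (by norm_num)]
  funext x
  have h3 := h2 (round_mem_Qs (x 0) (x 1))
  have h4 := per_round u hp (x 0) (x 1)
  rw [toE_surj] at h4
  simp only [h4, Pi.zero_apply, mul_eq_zero] at h3
  rcases h3 with h3 | h3
  · exact pow_eq_zero_iff (two_ne_zero) |>.1 h3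
  · exact absurd h3 (by have := hpos (toE (x 0 - round (x 0), x 1 - round (x 1))); positivity)

lemma grad_per (u : EuclideanSpace ℝ (Fin 2) → ℝ) (hp : ZsqPeriodic u) :
    ZsqPeriodic (fun x => ‖gradient u x‖ ^ 2) := by
  intro x i
  have : (fun x => u (x + EuclideanSpace.single i 1)) = u := by funext x; exact hp x i
  have h := fderiv_comp_add_right (𝕜 := ℝ) (f := u) (x := x) (EuclideanSpace.single i (1:ℝ))
  rw [this] at h
  simp only [gradient, h]

lemma grad_cont (u : EuclideanSpace ℝ (Fin 2) → ℝ) (hu : ContDiff ℝ (⊤ : ℕ∞) u) :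
    Continuous (fun x => ‖gradient u x‖ ^ 2) := by
  have hfc : Continuous (fderiv ℝ u) := hu.continuous_fderiv (by simp)
  unfold gradient
  fun_prop

lemma num_eq (u : EuclideanSpace ℝ (Fin 2) → ℝ) (hu : ContDiff ℝ (⊤ : ℕ∞) u) (hp : ZsqPeriodic u) :
    ∫ x in unitSquare, ‖gradient u x‖ ^ 2 = ∫ p in Qs, ‖gradient u (toE p)‖ ^ 2 :=
  integral_sq _ (grad_cont u hu) (grad_per u hp)

lemma den_eq (u : EuclideanSpace ℝ (Fin 2) → ℝ) (hu : Continuous u) (hp : ZsqPeriodic u) (α ε : ℝ) (hε : 0 < ε) :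
    ∫ x in unitSquare, u x ^ 2 * fae α ε x ^ 2 = ∫ p in Qs, u (toE p) ^ 2 * fae α ε (toE p) ^ 2 := by
  have hc := fae_cont α ε hε
  apply integral_sq (fun x => u x ^ 2 * fae α ε x ^ 2) (by fun_prop)
  intro x i
  simp only [hp x i, fae_per α ε x i]

lemma mean_eq (u : EuclideanSpace ℝ (Fin 2) → ℝ) (hu : Continuous u) (hp : ZsqPeriodic u) (α ε : ℝ) (hε : 0 < ε) :
    ∫ x in unitSquare, u x * fae α ε x ^ 2 = ∫ p in Qs, u (toE p) * fae α ε (toE p) ^ 2 := by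
  have hc := fae_cont α ε hε
  apply integral_sq (fun x => u x * fae α ε x ^ 2) (by fun_prop)
  intro x i
  simp only [hp x i, fae_per α ε x i]

lemma Kc_pos (α ε : ℝ) (hα0 : 0 < α) (hε : 0 < ε) (hεα : 8 * ε ≤ α) : 0 < Kc α ε := by
  unfold Kc
  have h1 : 48 * ε ^ 2 / α ^ 2 < 8 := by
    rw [div_lt_iff₀ (by positivity)]
    nlinarith
  have h2 : 0 < 8 - 48 * ε ^ 2 / α ^ 2 := by linarith
  have := Real.pi_pos
  positivity

lemma rayleigh_lower (α ε : ℝ) (hα0 : 0 < α) (hα : α < 1 / 2) (hε : 0 < ε) (hεα : 8 * ε ≤ α)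
    (u : EuclideanSpace ℝ (Fin 2) → ℝ) (hu : ContDiff ℝ (⊤ : ℕ∞) u) (hp : ZsqPeriodic u) (hne : u ≠ 0)
    (hm : (∫ x in unitSquare, u x * (fae α ε x) ^ 2) = 0) :
    1 / Kc α ε ≤ (∫ x in unitSquare, ‖gradient u x‖ ^ 2) / (∫ x in unitSquare, (u x) ^ 2 * (fae α ε x) ^ 2) := by
  have huc := hu.continuous
  rw [num_eq u hu hp, den_eq u huc hp α ε hε]
  rw [mean_eq u huc hp α ε hε] at hm
  have hd := den_pos u (fae α ε) huc (fae_cont α ε hε) hp (fae_pos α ε hε) hne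
  obtain ⟨Ux, Uy, hP, hg⟩ := hasPart_of_contDiff u hu
  have hc := core (fun p => u (toE p)) Ux Uy (fun p => fae α ε (toE p)) hP ((fae_cont α ε hε).comp toE_cont)
    α ε hα0 hα hε hεα (fun p hp hd => fae_in α ε hα0 p hp hd) (fun p hp hd => fae_out α ε p hp hd) hm
  simp only [hg]
  rw [div_le_div_iff₀ (Kc_pos α ε hα0 hε hεα) hd]
  linarith

lemma mu1_lower (α ε : ℝ) (hα0 : 0 < α) (hα : α < 1 / 2) (hε : 0 < ε) (hεα : 8 * ε ≤ α)
    (u : EuclideanSpace ℝ (Fin 2) → ℝ) (hu : ContDiff ℝ (⊤ : ℕ∞) u) (hp : ZsqPeriodic u) (hne : u ≠ 0)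
    (hm : (∫ x in unitSquare, u x * (fae α ε x) ^ 2) = 0) :
    1 / Kc α ε ≤ mu1 (fae α ε) ∧ mu1 (fae α ε) ≤
      (∫ p in Qs, ‖gradient u (toE p)‖ ^ 2) / (∫ p in Qs, (u (toE p)) ^ 2 * (fae α ε (toE p)) ^ 2) := by
  constructor
  · apply le_csInf
    · exact ⟨_, u, hu, hp, hne, hm, rfl⟩
    · rintro r ⟨v, hv, hvp, hvn, hvm, rfl⟩
      exact rayleigh_lower α ε hα0 hα hε hεα v hv hvp hvn hvm
  · rw [← num_eq u hu hp, ← den_eq u hu.continuous hp α ε hε]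
    apply csInf_le
    · refine ⟨1 / Kc α ε, ?_⟩
      rintro r ⟨v, hv, hvp, hvn, hvm, rfl⟩
      exact rayleigh_lower α ε hα0 hα hε hεα v hv hvp hvn hvm
    · exact ⟨u, hu, hp, hne, hm, rfl⟩

lemma Kc_lim (α : ℝ) (hα0 : 0 < α) :
    Tendsto (fun ε : ℝ => ε ^ 2 * (1 / Kc α ε)) (nhdsWithin 0 (Set.Ioi 0)) (nhds 8) := by
  have hpi := Real.pi_pos
  have h1 : Tendsto (fun ε : ℝ => (1 / (8 - 48 * ε ^ 2 / α ^ 2) +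
      1 / α ^ 4 * ((ε ^ 2 * (3 * π * α ^ 2 + 3) + ε * (12 * α ^ 3)) / (π * α ^ 2)))⁻¹)
      (nhdsWithin 0 (Set.Ioi 0)) (nhds 8) := by
    have : ContinuousAt (fun ε : ℝ => (1 / (8 - 48 * ε ^ 2 / α ^ 2) +
      1 / α ^ 4 * ((ε ^ 2 * (3 * π * α ^ 2 + 3) + ε * (12 * α ^ 3)) / (π * α ^ 2)))⁻¹) 0 := by
      apply ContinuousAt.inv₀
      · apply ContinuousAt.add
        · apply ContinuousAt.div (by fun_prop) (by fun_prop) (by norm_num)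
        · fun_prop
      · norm_num
    have h2 := this.tendsto.mono_left (nhdsWithin_le_nhds (s := Set.Ioi 0))
    norm_num at h2
    simpa using h2
  refine h1.congr' ?_
  filter_upwards [self_mem_nhdsWithin] with ε hε
  have hε : 0 < ε := hε
  have e : Kc α ε = ε ^ 2 * (1 / (8 - 48 * ε ^ 2 / α ^ 2) +
      1 / α ^ 4 * ((ε ^ 2 * (3 * π * α ^ 2 + 3) + ε * (12 * α ^ 3)) / (π * α ^ 2))) := by
    unfold Kc
    rw [mul_add, mul_one_div]
    congr 1
    field_simp
    ring
  rw [e, one_div (ε ^ 2 * _), mul_inv, ← mul_assoc (ε ^ 2) (ε ^ 2)⁻¹, mul_inv_cancel₀ (by positivity), one_mul]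

noncomputable def tu (ε : ℝ) (x : EuclideanSpace ℝ (Fin 2)) : ℝ :=
  ε * sin (2 * π * x 0) / (ε ^ 2 + sin (π * x 0) ^ 2 + sin (π * x 1) ^ 2)

lemma tu_toE (ε : ℝ) (p : ℝ × ℝ) : tu ε (toE p) =
    ε * sin (2 * π * p.1) / (ε ^ 2 + sin (π * p.1) ^ 2 + sin (π * p.2) ^ 2) := by
  simp [tu, toE]

lemma tu_smooth (ε : ℝ) (hε : 0 < ε) : ContDiff ℝ (⊤ : ℕ∞) (tu ε) := by
  unfold tu
  apply ContDiff.div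
  · fun_prop
  · fun_prop
  · intro x; positivity

lemma tu_per (ε : ℝ) : ZsqPeriodic (tu ε) := by
  intro x i
  have h1 : ∀ t : ℝ, sin (π * (t + 1)) ^ 2 = sin (π * t) ^ 2 := by
    intro t; rw [mul_add, mul_one, sin_add_pi]; ring
  have h2 : ∀ t : ℝ, sin (2 * π * (t + 1)) = sin (2 * π * t) := by
    intro t; rw [mul_add, mul_one, sin_add_two_pi]
  fin_cases i <;> simp [tu, h1, h2]

lemma fae_neg (α ε : ℝ) (p : ℝ × ℝ) (hp : p ∈ Qs) : fae α ε (toE (-p)) = fae α ε (toE p) := by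
  have hp' : -p ∈ Qs := by
    obtain ⟨⟨h1, h2⟩, h3, h4⟩ := hp
    refine ⟨⟨?_, ?_⟩, ?_, ?_⟩ <;> simp only [Prod.fst_neg, Prod.snd_neg] <;> linarith
  unfold fae
  rw [latticeDist_Q p hp, latticeDist_Q _ hp']
  simp

lemma tu_mean (α ε : ℝ) (hε : 0 < ε) : ∫ x in unitSquare, tu ε x * fae α ε x ^ 2 = 0 := by
  rw [mean_eq _ (tu_smooth ε hε).continuous (tu_per ε) α ε hε]
  have h1 := (Measure.measurePreserving_neg (volume : Measure (ℝ × ℝ))).setIntegral_preimage_emb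
    (Homeomorph.neg (ℝ × ℝ)).measurableEmbedding (fun p => tu ε (toE p) * fae α ε (toE p) ^ 2) Qs
  have h2 : (Neg.neg ⁻¹' Qs : Set (ℝ × ℝ)) = Qs := by
    ext p
    constructor
    · rintro ⟨⟨h1, h2⟩, h3, h4⟩
      simp only [Prod.fst_neg, Prod.snd_neg] at h1 h2 h3 h4
      refine ⟨⟨?_, ?_⟩, ?_, ?_⟩ <;> linarith
    · rintro ⟨⟨h1, h2⟩, h3, h4⟩
      refine ⟨⟨?_, ?_⟩, ?_, ?_⟩ <;> simp only [Prod.fst_neg, Prod.snd_neg] <;> linarith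
  rw [h2] at h1
  have h3 : ∫ p in Qs, tu ε (toE (-p)) * fae α ε (toE (-p)) ^ 2 =
      ∫ p in Qs, -(tu ε (toE p) * fae α ε (toE p) ^ 2) := by
    apply setIntegral_congr_fun Qs_meas
    intro p hp
    simp only [fae_neg α ε p hp, tu_toE]
    simp
    ring
  rw [integral_neg] at h3
  linarith

lemma sin_sq_lower (x : ℝ) (hx : x ∈ Set.Icc (-1/2 : ℝ) (1/2)) : 4 * x ^ 2 ≤ sin (π * x) ^ 2 := by
  have hpi := Real.pi_pos
  have hx' : |x| ≤ 1 / 2 := abs_le.2 ⟨by linarith [hx.1], hx.2⟩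
  have h1 := mul_le_sin (x := π * |x|) (by positivity) (by nlinarith)
  have h2 : 2 / π * (π * |x|) = 2 * |x| := by field_simp
  rw [h2] at h1
  have h3 : sin (π * |x|) ^ 2 = sin (π * x) ^ 2 := by
    rcases abs_choice x with h | h <;> rw [h]
    rw [mul_neg, sin_neg]; ring
  rw [← h3, ← sq_abs x]
  nlinarith [abs_nonneg x]

lemma tu_grad (ε : ℝ) (hε : 0 < ε) (p : ℝ × ℝ) : ‖gradient (tu ε) (toE p)‖ ^ 2 ≤
    52 * π ^ 2 * (ε / (ε ^ 2 + sin (π * p.1) ^ 2 + sin (π * p.2) ^ 2)) ^ 2 := by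
  have hpi := Real.pi_pos
  obtain ⟨Ux, Uy, hP, hg⟩ := hasPart_of_contDiff (tu ε) (tu_smooth ε hε)
  rw [hg]
  have hF := hP.2.2 p
  obtain ⟨x, y⟩ := p
  simp only
  set d := ε ^ 2 + sin (π * x) ^ 2 + sin (π * y) ^ 2 with hd
  have hdpos : 0 < d := by positivity
  have hS : sin (2 * π * x) = 2 * sin (π * x) * cos (π * x) := by
    rw [mul_assoc, sin_two_mul]
  -- x derivative
  have hx1 : HasDerivAt (fun s : ℝ => tu ε (toE (s, y))) (Ux (x, y)) x := by
    have h1 : HasDerivAt (fun s : ℝ => ((s, y) : ℝ × ℝ)) (1, 0) x :=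
      (hasDerivAt_id x).prodMk (hasDerivAt_const x y)
    have h2 := HasFDerivAt.comp_hasDerivAt x hF h1
    simpa using! h2
  have hy1 : HasDerivAt (fun s : ℝ => tu ε (toE (x, s))) (Uy (x, y)) y := by
    have h1 : HasDerivAt (fun s : ℝ => ((x, s) : ℝ × ℝ)) (0, 1) y :=
      (hasDerivAt_const y x).prodMk (hasDerivAt_id y)
    have h2 := HasFDerivAt.comp_hasDerivAt y hF h1
    simpa using! h2
  simp only [tu_toE] at hx1 hy1
  have hs : ∀ (c t : ℝ), HasDerivAt (fun s : ℝ => sin (c * s)) (cos (c * t) * c) t := by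
    intro c t
    have := ((hasDerivAt_id t).const_mul c).sin
    simpa using this
  have hx2 : HasDerivAt (fun s : ℝ => ε * sin (2 * π * s) / (ε ^ 2 + sin (π * s) ^ 2 + sin (π * y) ^ 2))
      ((ε * (cos (2 * π * x) * (2 * π)) * d - ε * sin (2 * π * x) * (2 * sin (π * x) * (cos (π * x) * π))) / d ^ 2) x := by
    have := ((hs (2 * π) x).const_mul ε).div ((((hs π x).pow 2).const_add (ε ^ 2)).add_const (sin (π * y) ^ 2)) hdpos.ne'
    refine HasDerivAt.congr_deriv this ?_
    simp [hd]
  have hy2 : HasDerivAt (fun s : ℝ => ε * sin (2 * π * x) / (ε ^ 2 + sin (π * x) ^ 2 + sin (π * s) ^ 2))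
      ((0 * d - ε * sin (2 * π * x) * (2 * sin (π * y) * (cos (π * y) * π))) / d ^ 2) y := by
    have := (hasDerivAt_const y (ε * sin (2 * π * x))).div (((hs π y).pow 2).const_add (ε ^ 2 + sin (π * x) ^ 2)) hdpos.ne'
    refine HasDerivAt.congr_deriv this ?_
    simp [hd]
  rw [hx1.unique hx2, hy1.unique hy2]
  set a := sin (π * x)
  set b := sin (π * y)
  have hca := Real.abs_cos_le_one (π * x)
  have hcb := Real.abs_cos_le_one (π * y)
  have hcx := Real.abs_cos_le_one (2 * π * x)
  rw [hS]
  set ca := cos (π * x)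
  set cb := cos (π * y)
  set cx := cos (2 * π * x)
  have ha : a ^ 2 ≤ d := by rw [hd]; nlinarith [sq_nonneg b, sq_nonneg ε]
  have hb : b ^ 2 ≤ d := by rw [hd]; nlinarith [sq_nonneg a, sq_nonneg ε]
  have hca2 : ca ^ 2 ≤ 1 := (sq_le_one_iff_abs_le_one _).2 hca
  have hcb2 : cb ^ 2 ≤ 1 := (sq_le_one_iff_abs_le_one _).2 hcb
  have k1 : (ε * (cx * (2 * π)) * d - ε * (2 * a * ca) * (2 * a * (ca * π))) / d ^ 2 =
      (2 * cx - 4 * (a ^ 2 / d) * ca ^ 2) * (π * (ε / d)) := by field_simp; ring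
  have k2 : (0 * d - ε * (2 * a * ca) * (2 * b * (cb * π))) / d ^ 2 = -(4 * (a * b / d) * (ca * cb)) * (π * (ε / d)) := by
    field_simp; ring
  rw [k1, k2]
  have l0 : 0 ≤ a ^ 2 / d := by positivity
  have l1 : a ^ 2 / d ≤ 1 := (div_le_one hdpos).2 ha
  have l2 : |2 * cx - 4 * (a ^ 2 / d) * ca ^ 2| ≤ 6 := by
    have : a ^ 2 / d * ca ^ 2 ≤ 1 := mul_le_one₀ l1 (by positivity) hca2
    have : 0 ≤ a ^ 2 / d * ca ^ 2 := by positivity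
    have := abs_le.1 hcx
    rw [abs_le]; constructor <;> linarith [this.1, this.2]
  have l3 : |-(4 * (a * b / d) * (ca * cb))| ≤ 4 := by
    have : |a * b / d| ≤ 1 := by
      rw [abs_div, abs_of_pos hdpos, div_le_one hdpos, abs_le]
      constructor <;> nlinarith [sq_nonneg (a + b), sq_nonneg (a - b)]
    rw [abs_neg, abs_mul, abs_mul, abs_mul ca cb]
    have h5 : |ca| * |cb| ≤ 1 := mul_le_one₀ hca (abs_nonneg _) hcb
    have h6 : |a * b / d| * (|ca| * |cb|) ≤ 1 := mul_le_one₀ this (by positivity) h5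
    rw [abs_of_pos (by norm_num : (0:ℝ) < 4)]
    linarith
  have m2 := sq_le_sq' (by linarith [(abs_le.1 l2).1]) (abs_le.1 l2).2
  have m3 := sq_le_sq' (by linarith [(abs_le.1 l3).1]) (abs_le.1 l3).2
  rw [mul_pow, mul_pow _ (π * (ε / d))]
  have : 0 ≤ (π * (ε / d)) ^ 2 := by positivity
  calc _ = ((2 * cx - 4 * (a ^ 2 / d) * ca ^ 2) ^ 2 + (-(4 * (a * b / d) * (ca * cb))) ^ 2) * (π * (ε / d)) ^ 2 := by ring
    _ ≤ (6 ^ 2 + 4 ^ 2) * (π * (ε / d)) ^ 2 := by gcongr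
    _ = _ := by ring

lemma g_int (ε : ℝ) (hε : 0 < ε) : ∫ x in Set.Icc (-1/2 : ℝ) (1/2), ε / (ε ^ 2 + 4 * x ^ 2) ≤ π / 2 := by
  rw [integral_Icc_eq_integral_Ioc, ← intervalIntegral.integral_of_le (by norm_num)]
  rw [intervalIntegral.integral_eq_sub_of_hasDerivAt (f := fun x => arctan (2 * x / ε) / 2)]
  · have := arctan_lt_pi_div_two (2 * (1 / 2) / ε)
    have := neg_pi_div_two_lt_arctan (2 * (-1 / 2) / ε)
    linarith
  · intro x _
    have h := ((((hasDerivAt_id x).const_mul 2).div_const ε).arctan).div_const 2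
    simp only [id] at h
    refine h.congr_deriv ?_
    field_simp
    try ring
  · apply Continuous.intervalIntegrable
    apply Continuous.div (by fun_prop) (by fun_prop)
    intro x; positivity

lemma tu_num (ε : ℝ) (hε : 0 < ε) : ∫ p in Qs, ‖gradient (tu ε) (toE p)‖ ^ 2 ≤ 13 * π ^ 4 := by
  have hpi := Real.pi_pos
  have hgc : Continuous fun x : ℝ => ε / (ε ^ 2 + 4 * x ^ 2) := by
    apply Continuous.div (by fun_prop) (by fun_prop)
    intro x; positivity
  have h1 : ∫ p in Qs, ‖gradient (tu ε) (toE p)‖ ^ 2 ≤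
      ∫ p in Qs, 52 * π ^ 2 * ((ε / (ε ^ 2 + 4 * p.1 ^ 2)) * (ε / (ε ^ 2 + 4 * p.2 ^ 2))) := by
    apply setIntegral_mono_on (Qs_integrable ((grad_cont _ (tu_smooth ε hε)).comp toE_cont)) (Qs_integrable _) Qs_meas
    · intro p hp
      refine (tu_grad ε hε p).trans ?_
      have s1 := sin_sq_lower p.1 hp.1
      have s2 := sin_sq_lower p.2 hp.2
      rw [sq (ε / _)]
      have t1 : ε / (ε ^ 2 + sin (π * p.1) ^ 2 + sin (π * p.2) ^ 2) ≤ ε / (ε ^ 2 + 4 * p.1 ^ 2) :=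
        div_le_div_of_nonneg_left hε.le (by positivity) (by nlinarith [sq_nonneg p.2])
      have t2 : ε / (ε ^ 2 + sin (π * p.1) ^ 2 + sin (π * p.2) ^ 2) ≤ ε / (ε ^ 2 + 4 * p.2 ^ 2) :=
        div_le_div_of_nonneg_left hε.le (by positivity) (by nlinarith [sq_nonneg p.1])
      gcongr
    · have h1 := hgc.comp continuous_fst (X := ℝ × ℝ)
      have h2 := hgc.comp continuous_snd (X := ℝ × ℝ)
      exact continuous_const.mul (h1.mul h2)
  refine h1.trans ?_
  rw [integral_const_mul]
  have h2 := setIntegral_prod_mul (μ := (volume : Measure ℝ)) (ν := (volume : Measure ℝ)) (fun x : ℝ => ε / (ε ^ 2 + 4 * x ^ 2))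
    (fun x : ℝ => ε / (ε ^ 2 + 4 * x ^ 2)) (Set.Icc (-1/2 : ℝ) (1/2)) (Set.Icc (-1/2 : ℝ) (1/2))
  have h3 := g_int ε hε
  have h4 : 0 ≤ ∫ x in Set.Icc (-1/2 : ℝ) (1/2), ε / (ε ^ 2 + 4 * x ^ 2) := integral_nonneg fun x => by positivity
  have h5 : ∫ p in Qs, (ε / (ε ^ 2 + 4 * p.1 ^ 2)) * (ε / (ε ^ 2 + 4 * p.2 ^ 2)) ≤ (π / 2) * (π / 2) := by
    unfold Qs
    rw [Measure.volume_eq_prod, h2]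
    gcongr
  calc _ ≤ 52 * π ^ 2 * ((π / 2) * (π / 2)) := by gcongr
    _ = _ := by ring

lemma tu_den (α ε : ℝ) (hα0 : 0 < α) (hα : α < 1 / 2) (hε : 0 < ε) (hεα : 8 * ε ≤ α) :
    ε ^ 2 * (2 / (9 * (1 + 2 * π ^ 2) ^ 2)) ≤ ∫ p in Qs, (tu ε (toE p)) ^ 2 * (fae α ε (toE p)) ^ 2 := by
  have hpi := Real.pi_pos
  have hsub : Set.Icc (ε / 2) ε ×ˢ Set.Icc 0 ε ⊆ Qs := by
    rintro ⟨x, y⟩ ⟨⟨h1, h2⟩, h3, h4⟩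
    simp only at h1 h2 h3 h4
    refine ⟨⟨?_, ?_⟩, ?_, ?_⟩ <;> simp only <;> linarith
  have hc : Continuous fun p => (tu ε (toE p)) ^ 2 * (fae α ε (toE p)) ^ 2 := by
    have h1 := (tu_smooth ε hε).continuous
    have h2 := fae_cont α ε hε
    have := toE_cont
    fun_prop
  have h1 : ∫ p in Set.Icc (ε / 2) ε ×ˢ Set.Icc 0 ε, (tu ε (toE p)) ^ 2 * (fae α ε (toE p)) ^ 2 ≤
      ∫ p in Qs, (tu ε (toE p)) ^ 2 * (fae α ε (toE p)) ^ 2 :=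
    setIntegral_mono_set (Qs_integrable hc) (Eventually.of_forall fun p => by
      show 0 ≤ (tu ε (toE p)) ^ 2 * (fae α ε (toE p)) ^ 2
      positivity) hsub.eventuallyLE
  refine le_trans ?_ h1
  have h2 : ∫ p in Set.Icc (ε / 2) ε ×ˢ Set.Icc 0 ε, ((2 / (1 + 2 * π ^ 2)) ^ 2 * (1 / 3) ^ 2 : ℝ) ≤
      ∫ p in Set.Icc (ε / 2) ε ×ˢ Set.Icc 0 ε, (tu ε (toE p)) ^ 2 * (fae α ε (toE p)) ^ 2 := by
    apply setIntegral_mono_on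
    · exact (continuous_const.continuousOn).integrableOn_compact (isCompact_Icc.prod isCompact_Icc)
    · exact (Qs_integrable hc).mono_set hsub
    · exact measurableSet_Icc.prod measurableSet_Icc
    · intro p hp
      have hQ := hsub hp
      obtain ⟨⟨a1, a2⟩, a3, a4⟩ := hp
      have hD : p ∈ Dsc α := by
        show p.1 ^ 2 + p.2 ^ 2 ≤ α ^ 2
        nlinarith
      have b1 : 1 / 3 ≤ fae α ε (toE p) := by
        rw [fae_in α ε hα0 p hQ hD, div_le_div_iff₀ (by norm_num) (by positivity)]
        nlinarith
      have b2 : 2 / (1 + 2 * π ^ 2) ≤ tu ε (toE p) := by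
        rw [tu_toE]
        have c1 := mul_le_sin (x := 2 * π * p.1) (by nlinarith) (by nlinarith)
        have c2 : 2 / π * (2 * π * p.1) = 4 * p.1 := by field_simp; ring
        rw [c2] at c1
        have c3 : ∀ t : ℝ, 0 ≤ t → t ≤ ε → sin (π * t) ^ 2 ≤ π ^ 2 * ε ^ 2 := by
          intro t t0 t1
          have e1 := Real.abs_sin_le_abs (x := π * t)
          rw [abs_of_nonneg (by positivity : 0 ≤ π * t)] at e1
          have e2 : |sin (π * t)| ≤ π * ε := e1.trans (by gcongr)
          have e3 := pow_le_pow_left₀ (abs_nonneg _) e2 2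
          rw [sq_abs, mul_pow] at e3
          exact e3
        have d1 := c3 p.1 (by linarith) a2
        have d2 := c3 p.2 a3 a4
        calc 2 / (1 + 2 * π ^ 2) = (ε * (2 * ε)) / (ε ^ 2 + π ^ 2 * ε ^ 2 + π ^ 2 * ε ^ 2) := by
              field_simp; ring
          _ ≤ _ := by
              have : 0 ≤ sin (2 * π * p.1) := by linarith
              gcongr
              linarith
      gcongr
  refine le_trans (le_of_eq ?_) h2
  rw [setIntegral_const, Measure.volume_eq_prod, measureReal_prod_prod]
  simp only [Real.volume_real_Icc, smul_eq_mul]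
  rw [max_eq_left (by linarith), max_eq_left (by linarith)]
  field_simp
  ring

lemma mu1_bounds (α ε : ℝ) (hα0 : 0 < α) (hα : α < 1 / 2) (hε : 0 < ε) (hεα : 8 * ε ≤ α) :
    1 / Kc α ε ≤ mu1 (fae α ε) ∧
    ε ^ 2 * mu1 (fae α ε) ≤ 13 * π ^ 4 / (2 / (9 * (1 + 2 * π ^ 2) ^ 2)) := by
  have hpi := Real.pi_pos
  have hden := tu_den α ε hα0 hα hε hεα
  have hnum := tu_num ε hε
  have hcpos : 0 < ε ^ 2 * (2 / (9 * (1 + 2 * π ^ 2) ^ 2)) := by positivity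
  have hne : tu ε ≠ 0 := by
    intro h
    rw [h] at hden
    simp at hden
    have : 0 < ε ^ 2 * (2 / (9 * (1 + 2 * π ^ 2) ^ 2)) := by positivity
    linarith
  obtain ⟨h1, h2⟩ := mu1_lower α ε hα0 hα hε hεα (tu ε) (tu_smooth ε hε) (tu_per ε) hne (tu_mean α ε hε)
  refine ⟨h1, ?_⟩
  have h3 : mu1 (fae α ε) ≤ 13 * π ^ 4 / (ε ^ 2 * (2 / (9 * (1 + 2 * π ^ 2) ^ 2))) := by
    refine h2.trans ?_
    gcongr
  calc _ ≤ ε ^ 2 * (13 * π ^ 4 / (ε ^ 2 * (2 / (9 * (1 + 2 * π ^ 2) ^ 2)))) := by gcongr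
    _ = _ := by field_simp

lemma disc_vol (α ε : ℝ) (hα0 : 0 < α) (hε : 0 < ε) :
    ∫ p in Dsc α, (ε ^ 2 / (ε ^ 2 + (p.1 ^ 2 + p.2 ^ 2))) ^ 2 = ε ^ 2 * (π * α ^ 2 / (ε ^ 2 + α ^ 2)) := by
  rw [polar_disc α hα0 (fun p => (ε ^ 2 / (ε ^ 2 + (p.1 ^ 2 + p.2 ^ 2))) ^ 2)]
  · have h1 : ∀ r t : ℝ, (ε ^ 2 / (ε ^ 2 + ((r * cos t) ^ 2 + (r * sin t) ^ 2))) ^ 2 = (ε ^ 2 / (ε ^ 2 + r ^ 2)) ^ 2 := by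
      intro r t
      have : (r * cos t) ^ 2 + (r * sin t) ^ 2 = r ^ 2 := by
        rw [mul_pow, mul_pow, ← mul_add, cos_sq_add_sin_sq, mul_one]
      rw [this]
    simp only [h1, intervalIntegral.integral_const, smul_eq_mul]
    rw [intervalIntegral.integral_eq_sub_of_hasDerivAt (f := fun r => -(π * ε ^ 4) * (ε ^ 2 + r ^ 2)⁻¹)]
    · field_simp
      ring
    · intro r _
      have h := ((((hasDerivAt_id r).pow 2).const_add (ε ^ 2)).inv (by simp; positivity)).const_mul (-(π * ε ^ 4))
      refine HasDerivAt.congr_deriv h ?_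
      simp
      field_simp
      ring
    · apply Continuous.intervalIntegrable
      have : ∀ r : ℝ, ε ^ 2 + r ^ 2 ≠ 0 := fun r => by positivity
      fun_prop (disch := assumption)
  · have : ∀ p : ℝ × ℝ, ε ^ 2 + (p.1 ^ 2 + p.2 ^ 2) ≠ 0 := fun r => by positivity
    fun_prop (disch := assumption)

lemma vol_bounds (α ε : ℝ) (hα0 : 0 < α) (hα : α < 1 / 2) (hε : 0 < ε) :
    ε ^ 2 * (π * α ^ 2 / (ε ^ 2 + α ^ 2)) ≤ ∫ x in unitSquare, (fae α ε x) ^ 2 ∧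
    ∫ x in unitSquare, (fae α ε x) ^ 2 ≤ ε ^ 2 * (π + 1 / α ^ 2) := by
  have hpi := Real.pi_pos
  have hfc := fae_cont α ε hε
  have hc : Continuous fun p => (fae α ε (toE p)) ^ 2 := by
    have := toE_cont
    fun_prop
  have hsub := Dsc_sub α hα0 hα
  rw [integral_sq (fun x => (fae α ε x) ^ 2) (by fun_prop) (fun x i => by simp only [fae_per α ε x i])]
  have hD : ∫ p in Dsc α, (fae α ε (toE p)) ^ 2 = ε ^ 2 * (π * α ^ 2 / (ε ^ 2 + α ^ 2)) := by
    rw [← disc_vol α ε hα0 hε]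
    apply setIntegral_congr_fun (Dsc_meas α)
    intro p hp
    simp only [fae_in α ε hα0 p (hsub hp) hp]
  have hI := Qs_integrable hc
  have hsplit : ∫ p in Qs, (fae α ε (toE p)) ^ 2 =
      (∫ p in Dsc α, (fae α ε (toE p)) ^ 2) + ∫ p in Qs \ Dsc α, (fae α ε (toE p)) ^ 2 := by
    rw [← setIntegral_union disjoint_sdiff_self_right (Qs_meas.diff (Dsc_meas α))
      (hI.mono_set hsub) (hI.mono_set Set.sdiff_subset), Set.union_sdiff_cancel hsub]
  have hlo : 0 ≤ ∫ p in Qs \ Dsc α, (fae α ε (toE p)) ^ 2 := integral_nonneg fun p => by positivity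
  have hic : IntegrableOn (fun _ : ℝ × ℝ => ε ^ 2 / α ^ 2) Qs := Qs_integrable continuous_const
  have hhi : ∫ p in Qs \ Dsc α, (fae α ε (toE p)) ^ 2 ≤ ε ^ 2 / α ^ 2 := by
    calc _ ≤ ∫ _p in Qs \ Dsc α, ε ^ 2 / α ^ 2 := by
          apply setIntegral_mono_on (hI.mono_set Set.sdiff_subset) (hic.mono_set Set.sdiff_subset)
            (Qs_meas.diff (Dsc_meas α))
          intro p hp
          rw [fae_out α ε p hp.1 hp.2, sq (ε ^ 2 / _)]
          have h1 : ε ^ 2 / (ε ^ 2 + α ^ 2) ≤ 1 := (div_le_one (by positivity)).2 (by nlinarith)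
          have h2 : ε ^ 2 / (ε ^ 2 + α ^ 2) ≤ ε ^ 2 / α ^ 2 := by
            gcongr
            nlinarith
          have h3 : 0 ≤ ε ^ 2 / (ε ^ 2 + α ^ 2) := by positivity
          nlinarith
      _ ≤ ∫ _p in Qs, ε ^ 2 / α ^ 2 := by
          apply setIntegral_mono_set hic (Eventually.of_forall fun p => ?_) Set.sdiff_subset.eventuallyLE
          show 0 ≤ ε ^ 2 / α ^ 2
          positivity
      _ = ε ^ 2 / α ^ 2 * ∫ _p in Qs, (1 : ℝ) := by
          rw [← integral_const_mul]; simp only [mul_one]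
      _ = _ := by rw [Qs_vol, mul_one]
  rw [hsplit, hD]
  constructor
  · linarith
  · have : π * α ^ 2 / (ε ^ 2 + α ^ 2) ≤ π := by
      rw [div_le_iff₀ (by positivity)]
      nlinarith [mul_pos hpi (pow_pos hε 2)]
    calc _ ≤ ε ^ 2 * π + ε ^ 2 / α ^ 2 := by gcongr
      _ = _ := by ring

lemma liminf_aux (F g : ℝ → ℝ) (L C : ℝ) (hg : Tendsto g (nhdsWithin 0 (Set.Ioi 0)) (nhds L))
    (h1 : ∀ᶠ ε in nhdsWithin (0:ℝ) (Set.Ioi 0), g ε ≤ F ε)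
    (h2 : ∀ᶠ ε in nhdsWithin (0:ℝ) (Set.Ioi 0), F ε ≤ C) :
    L ≤ Filter.liminf F (nhdsWithin 0 (Set.Ioi 0)) := by
  have hcob : IsCoboundedUnder (· ≥ ·) (nhdsWithin (0:ℝ) (Set.Ioi 0)) F :=
    IsBoundedUnder.isCoboundedUnder_ge ⟨C, by simpa only [eventually_map] using h2⟩
  apply le_of_forall_lt_imp_le_of_dense
  intro b hb
  apply le_liminf_of_le hcob
  filter_upwards [h1, hg.eventually (lt_mem_nhds hb)] with ε h3 h4
  linarith

theorem stmt_8 (α : ℝ) (hα0 : 0 < α) (hα : α < 1 / 2) :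
    8 * π ≤ Filter.liminf (fun ε : ℝ =>
        mu1 (fae α ε) * ∫ x in unitSquare, (fae α ε x) ^ 2)
      (nhdsWithin 0 (Set.Ioi 0)) ∧
    8 ≤ Filter.liminf (fun ε : ℝ => ε ^ 2 * mu1 (fae α ε))
      (nhdsWithin 0 (Set.Ioi 0)) := by
  have hpi := Real.pi_pos
  have hsmall : ∀ᶠ ε in nhdsWithin (0:ℝ) (Set.Ioi 0), 0 < ε ∧ 8 * ε ≤ α := by
    have h : ∀ᶠ ε in nhdsWithin (0:ℝ) (Set.Ioi 0), ε < α / 8 :=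
      nhdsWithin_le_nhds (gt_mem_nhds (by positivity))
    filter_upwards [self_mem_nhdsWithin, h] with ε h1 h2
    exact ⟨h1, by linarith⟩
  have hlim := Kc_lim α hα0
  constructor
  · have hlim2 : Tendsto (fun ε : ℝ => ε ^ 2 * (1 / Kc α ε) * (π * α ^ 2 / (ε ^ 2 + α ^ 2)))
        (nhdsWithin 0 (Set.Ioi 0)) (nhds (8 * π)) := by
      apply hlim.mul
      have hc : ContinuousAt (fun ε : ℝ => π * α ^ 2 / (ε ^ 2 + α ^ 2)) 0 := by
        apply ContinuousAt.div (by fun_prop) (by fun_prop)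
        positivity
      have h2 := hc.tendsto.mono_left (nhdsWithin_le_nhds (s := Set.Ioi 0))
      have e : π * α ^ 2 / ((0:ℝ) ^ 2 + α ^ 2) = π := by field_simp; simp
      rwa [e] at h2
    refine liminf_aux _ _ _ (13 * π ^ 4 / (2 / (9 * (1 + 2 * π ^ 2) ^ 2)) * (π + 1 / α ^ 2)) hlim2 ?_ ?_
    · filter_upwards [hsmall] with ε hε
      obtain ⟨hε, hεα⟩ := hε
      have hK := Kc_pos α ε hα0 hε hεα
      have hm := (mu1_bounds α ε hα0 hα hε hεα).1
      have hv := (vol_bounds α ε hα0 hα hε).1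
      have hm0 : 0 ≤ mu1 (fae α ε) := le_trans (by positivity) hm
      calc _ = 1 / Kc α ε * (ε ^ 2 * (π * α ^ 2 / (ε ^ 2 + α ^ 2))) := by ring
        _ ≤ _ := by gcongr
    · filter_upwards [hsmall] with ε hε
      obtain ⟨hε, hεα⟩ := hε
      have hK := Kc_pos α ε hα0 hε hεα
      have hm := mu1_bounds α ε hα0 hα hε hεα
      have hv := (vol_bounds α ε hα0 hα hε).2
      have hm0 : 0 ≤ mu1 (fae α ε) := le_trans (by positivity) hm.1
      calc _ ≤ mu1 (fae α ε) * (ε ^ 2 * (π + 1 / α ^ 2)) := by gcongr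
        _ = ε ^ 2 * mu1 (fae α ε) * (π + 1 / α ^ 2) := by ring
        _ ≤ _ := by gcongr; exact hm.2
  · refine liminf_aux _ _ _ (13 * π ^ 4 / (2 / (9 * (1 + 2 * π ^ 2) ^ 2))) hlim ?_ ?_
    · filter_upwards [hsmall] with ε hε
      have hm := (mu1_bounds α ε hα0 hα hε.1 hε.2).1
      gcongr
    · filter_upwards [hsmall] with ε hε
      exact (mu1_bounds α ε hα0 hα hε.1 hε.2).2
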